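/- arXiv:1201.4367 — 6 statements merged into one kernel-verified Lean document; each statement's English description precedes it below -/
import Mathlib

section
/- For every finite group Γ, there exists a finite simple graph G whose automorphism group is isomorphic to Γ. -/
namespace FruchtAux

variable {Γ : Type} [Group Γ] {m : ℕ}

/-- Voltages between layers. -/
def volt (a : Fin m → Γ) (i j : Fin m) : Γ :=
  if i.val = 1 ∧ 2 ≤ j.val then a j
  else if j.val = 1 ∧ 2 ≤ i.val then (a i)⁻¹ else 1

lemma volt_inv (a : Fin m → Γ) (i j : Fin m) : volt a j i = (volt a i j)⁻¹ := by
  unfold volt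
  split_ifs <;> first | omega | simp

lemma volt_self (a : Fin m → Γ) (i : Fin m) : volt a i i = 1 := by
  unfold volt
  split_ifs <;> first | omega | simp

/-- The graph. -/
def gr (a : Fin m → Γ) : SimpleGraph (Γ × Fin m) where
  Adj v w := v ≠ w ∧ ((v.1 * volt a v.2 w.2 = w.1) ↔ ¬ (m ≤ v.2.val + w.2.val))
  symm := ⟨by
    rintro v w ⟨h1, h2⟩
    refine ⟨h1.symm, ?_⟩
    rw [volt_inv a v.2 w.2, mul_inv_eq_iff_eq_mul, eq_comm, h2, add_comm]⟩
  loopless := ⟨fun v h => h.1 rfl⟩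

lemma gr_adj (a : Fin m → Γ) (v w : Γ × Fin m) : (gr a).Adj v w ↔
    v ≠ w ∧ ((v.1 * volt a v.2 w.2 = w.1) ↔ ¬ (m ≤ v.2.val + w.2.val)) := Iff.rfl

/-- Left translation. -/
def tr (a : Fin m → Γ) : Γ →* (gr a ≃g gr a) where
  toFun c :=
    { toFun := fun v => (c * v.1, v.2)
      invFun := fun v => (c⁻¹ * v.1, v.2)
      left_inv := fun v => by simp
      right_inv := fun v => by simp
      map_rel_iff' := by
        intro v w
        simp [gr_adj, Prod.ext_iff, mul_assoc] }
  map_one' := by ext v <;> simp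
  map_mul' c d := by ext v <;> simp [mul_assoc]

lemma count_T (i : Fin m) :
    (Finset.univ.filter (fun j : Fin m => m ≤ i.val + j.val)).card = i.val := by
  have : (Finset.univ.filter (fun j : Fin m => m ≤ i.val + j.val)).card
      = (Finset.Ico (m - i.val) m).card := by
    apply Finset.card_bij (fun j _ => j.val)
    · intro j hj
      simp at hj ⊢
      omega
    · intro j _ k _ h
      exact Fin.ext h
    · intro b hb
      simp at hb
      exact ⟨⟨b, hb.2⟩, by simp; omega, rfl⟩
  rw [this]
  simp
  omega

open Classical in
lemma deg_eq [Fintype Γ] (a : Fin m → Γ) (v : Γ × Fin m) :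
    (Finset.univ.filter (fun w => (gr a).Adj v w)).card +
      (if m ≤ v.2.val + v.2.val then 0 else 1)
      = v.2.val * (Fintype.card Γ - 1) + (m - v.2.val) := by
  obtain ⟨g, i⟩ := v
  set P : Γ × Fin m → Prop := fun w => (g * volt a i w.2 = w.1) ↔ ¬ (m ≤ i.val + w.2.val) with hP
  have h1 : (Finset.univ.filter (fun w => (gr a).Adj (g, i) w))
      = (Finset.univ.filter P).erase (g, i) := by
    ext w
    simp [gr_adj, hP, eq_comm]
  have h2 : (Finset.univ.filter P).card = i.val * (Fintype.card Γ - 1) + (m - i.val) := by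
    rw [Finset.card_filter, Fintype.sum_prod_type_right]
    have : ∀ j : Fin m, (∑ x : Γ, if P (x, j) then 1 else 0)
        = if m ≤ i.val + j.val then Fintype.card Γ - 1 else 1 := by
      intro j
      rw [← Finset.card_filter]
      by_cases hT : m ≤ i.val + j.val
      · simp only [hP, hT, not_true, iff_false, if_true]
        have : (Finset.univ.filter (fun x : Γ => ¬ (g * volt a i j = x)))
          = Finset.univ.erase (g * volt a i j) := by ext; simp [eq_comm]
        rw [this]; simp
      · simp only [hP, hT, not_false_eq_true, iff_true, if_false]
        rw [Finset.card_eq_one]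
        exact ⟨g * volt a i j, by ext; simp [eq_comm]⟩
    rw [Finset.sum_congr rfl (fun j _ => this j)]
    rw [Finset.sum_ite]
    have h3 := Finset.card_filter_add_card_filter_not (s := Finset.univ)
      (fun j : Fin m => m ≤ i.val + j.val)
    rw [count_T] at h3
    simp only [Finset.sum_const, smul_eq_mul, count_T, mul_one]
    simp only [Finset.card_univ, Fintype.card_fin] at h3
    omega
  have h4 : P (g, i) ↔ ¬ (m ≤ i.val + i.val) := by simp [hP, volt_self]
  rw [h1, ← h2]
  by_cases hT : m ≤ i.val + i.val
  · rw [Finset.erase_eq_of_notMem]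
    · simp [hT]
    · simp [h4, hT]
  · simp only [hT, if_false]
    apply Finset.card_erase_add_one
    simp only [Finset.mem_filter, Finset.mem_univ, true_and]
    exact h4.2 hT

lemma layer_eq [Fintype Γ] (hn : 3 ≤ Fintype.card Γ) (a : Fin m → Γ) (φ : gr a ≃g gr a)
    (v : Γ × Fin m) : (φ v).2 = v.2 := by
  classical
  have h1 := deg_eq a v
  have h2 := deg_eq a (φ v)
  have h3 : (Finset.univ.filter (fun w => (gr a).Adj v w)).card
      = (Finset.univ.filter (fun w => (gr a).Adj (φ v) w)).card := by
    apply Finset.card_bij (fun w _ => φ w)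
    · intro w hw
      simp only [Finset.mem_filter, Finset.mem_univ, true_and] at hw ⊢
      exact φ.map_adj_iff.2 hw
    · intro w _ w' _ h
      exact φ.injective h
    · intro b hb
      refine ⟨φ.symm b, ?_, by simp⟩
      have : (gr a).Adj (φ v) (φ (φ.symm b)) := by simpa using hb
      simpa using φ.map_adj_iff.1 this
  obtain ⟨k, hk⟩ : ∃ k, Fintype.card Γ - 1 = k + 2 := ⟨Fintype.card Γ - 3, by omega⟩
  rw [hk] at h1 h2
  have key : ∀ x y d : ℕ, x < y → y < m →
      d + (if m ≤ x + x then 0 else 1) = x * (k + 2) + (m - x) →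
      d + (if m ≤ y + y then 0 else 1) = y * (k + 2) + (m - y) → False := by
    intro x y d hxy hy e1 e2
    have : x * k ≤ y * k := Nat.mul_le_mul_right _ hxy.le
    rw [mul_add] at e1 e2
    split_ifs at e1 e2 <;> omega
  rw [← h3] at h2
  rcases lt_trichotomy (φ v).2.val v.2.val with h | h | h
  · exact (key _ _ _ h v.2.isLt h2 h1).elim
  · exact Fin.ext h
  · exact (key _ _ _ h (φ v).2.isLt h1 h2).elim

lemma tr_bij [Fintype Γ] (hn : 3 ≤ Fintype.card Γ) (hm : 2 ≤ m) (a : Fin m → Γ)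
    (ha : ∀ x, ∃ j : Fin m, 2 ≤ j.val ∧ a j = x) : Function.Bijective (tr a) := by
  constructor
  · intro c d h
    have := congrArg (fun φ : gr a ≃g gr a => (φ (1, ⟨0, by omega⟩)).1) h
    simpa [tr] using this
  · intro φ
    have hl := layer_eq hn a φ
    have hmatch : ∀ (i j : Fin m) (g : Γ), i ≠ j →
        (φ (g * volt a i j, j)).1 = (φ (g, i)).1 * volt a i j := by
      intro i j g hij
      have h := φ.map_adj_iff (v := (g, i)) (w := (g * volt a i j, j))
      have n1 : ((g, i) : Γ × Fin m) ≠ (g * volt a i j, j) := fun e => hij (congrArg Prod.snd e)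
      have n2 : φ (g, i) ≠ φ (g * volt a i j, j) := fun e => n1 (φ.injective e)
      rw [gr_adj, gr_adj] at h
      simp only [hl, n1, n2, ne_eq, not_false_eq_true, true_and, true_iff] at h
      symm
      tauto
    set z : Fin m := ⟨0, by omega⟩ with hz
    have h0 : ∀ (j : Fin m) (g : Γ), (φ (g, j)).1 = (φ (g, z)).1 := by
      intro j g
      by_cases hj : z = j
      · rw [hj]
      · have := hmatch z j g hj
        have hv : volt a z j = 1 := by simp [volt, hz]
        simpa [hv] using this
    have h1 : ∀ g x : Γ, (φ (g * x, z)).1 = (φ (g, z)).1 * x := by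
      intro g x
      obtain ⟨j, hj, rfl⟩ := ha x
      have hne : (⟨1, by omega⟩ : Fin m) ≠ j := by
        intro e
        rw [← e] at hj
        simp at hj
      have := hmatch ⟨1, by omega⟩ j g hne
      have hv : volt a ⟨1, by omega⟩ j = a j := by simp [volt, hj]
      rw [hv] at this
      rw [← h0 j, this, h0]
    refine ⟨(φ (1, z)).1, ?_⟩
    apply RelIso.ext
    rintro ⟨g, i⟩
    apply Prod.ext
    · change (φ (1, z)).1 * g = (φ (g, i)).1
      rw [h0 i, ← h1, one_mul]
    · exact (hl (g, i)).symm

end FruchtAux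

/-- **Frucht's theorem.** For every finite group `Γ`, there exists a finite simple
graph `G` whose automorphism group is isomorphic to `Γ`. -/
theorem frucht (Γ : Type) [Group Γ] [Finite Γ] :
    ∃ (V : Type) (_ : Fintype V) (G : SimpleGraph V),
      Nonempty ((G ≃g G) ≃* Γ) := by
  classical
  have : Fintype Γ := Fintype.ofFinite Γ
  by_cases hn : 3 ≤ Fintype.card Γ
  · let e := Fintype.equivFin Γ
    let a : Fin (Fintype.card Γ + 2) → Γ := fun j =>
      if h : 2 ≤ j.val then e.symm ⟨j.val - 2, by omega⟩ else 1
    have ha : ∀ x, ∃ j : Fin (Fintype.card Γ + 2), 2 ≤ j.val ∧ a j = x := by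
      intro x
      refine ⟨⟨(e x).val + 2, by omega⟩, by simp, ?_⟩
      simp [a]
    exact ⟨Γ × Fin (Fintype.card Γ + 2), inferInstance, FruchtAux.gr a,
      ⟨(MulEquiv.ofBijective _ (FruchtAux.tr_bij hn (by omega) a ha)).symm⟩⟩
  · refine ⟨Γ, inferInstance, ⊥, ?_⟩
    let E : ((⊥ : SimpleGraph Γ) ≃g (⊥ : SimpleGraph Γ)) ≃ Equiv.Perm Γ :=
      { toFun := fun φ => φ.toEquiv
        invFun := fun p => ⟨p, by simp⟩
        left_inv := fun _ => rfl
        right_inv := fun _ => rfl }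
    have hc : Nat.card ((⊥ : SimpleGraph Γ) ≃g (⊥ : SimpleGraph Γ)) = (Fintype.card Γ).factorial := by
      rw [Nat.card_congr E, Nat.card_eq_fintype_card, Fintype.card_perm]
    have hpos : 0 < Fintype.card Γ := Fintype.card_pos
    have hcases : Fintype.card Γ = 1 ∨ Fintype.card Γ = 2 := by omega
    rcases hcases with h | h
    · rw [h] at hc
      have s1 := (Nat.card_eq_one_iff_unique.1 hc).1
      have s2 : Subsingleton Γ := Fintype.card_le_one_iff_subsingleton.1 h.le
      exact ⟨{ toFun := fun _ => 1
               invFun := fun _ => 1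
               left_inv := fun _ => Subsingleton.elim _ _
               right_inv := fun _ => Subsingleton.elim _ _
               map_mul' := fun _ _ => Subsingleton.elim _ _ }⟩
    · rw [h] at hc
      have : Fact (Nat.Prime 2) := ⟨Nat.prime_two⟩
      exact ⟨mulEquivOfPrimeCardEq (p := 2) hc (by rw [Nat.card_eq_fintype_card, h])⟩
end

section
/- For every finite group Γ, there exists a finite connected simple graph G and a vertex v ∈ V(G) such that Aut(G) is isomorphic to Γ and the stabilizer of v in Aut(G) is the trivial subgroup. -/
namespace FruchtAux

variable {Γ : Type} [Group Γ] {m : ℕ}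

/-- Adjacency: points form a clique, each fibre of cells is a clique, and the point `h` is adjacent
to the cell `(g, k)` iff the index of `g⁻¹ h` is at most `k`. -/
def adj (e : Γ ≃ Fin (m + 1)) : Γ ⊕ (Γ × Fin (m + 1)) → Γ ⊕ (Γ × Fin (m + 1)) → Prop
  | .inl g, .inl h => g ≠ h
  | .inl h, .inr c => e (c.1⁻¹ * h) ≤ c.2
  | .inr c, .inl h => e (c.1⁻¹ * h) ≤ c.2
  | .inr c, .inr d => c.1 = d.1 ∧ c.2 ≠ d.2

def graph (e : Γ ≃ Fin (m + 1)) : SimpleGraph (Γ ⊕ (Γ × Fin (m + 1))) where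
  Adj := adj e
  symm := ⟨by
    rintro (g | c) (h | d) H
    · exact Ne.symm H
    · exact H
    · exact H
    · exact ⟨H.1.symm, H.2.symm⟩⟩
  loopless := ⟨by
    rintro (g | c) H
    · exact H rfl
    · exact H.2 rfl⟩

variable (e : Γ ≃ Fin (m + 1))

lemma adj_ll (g h : Γ) : (graph e).Adj (.inl g) (.inl h) ↔ g ≠ h := Iff.rfl
lemma adj_lr (h : Γ) (c) : (graph e).Adj (.inl h) (.inr c) ↔ e (c.1⁻¹ * h) ≤ c.2 := Iff.rfl
lemma adj_rl (h : Γ) (c) : (graph e).Adj (.inr c) (.inl h) ↔ e (c.1⁻¹ * h) ≤ c.2 := Iff.rfl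
lemma adj_rr (c d : Γ × Fin (m + 1)) :
    (graph e).Adj (.inr c) (.inr d) ↔ c.1 = d.1 ∧ c.2 ≠ d.2 := Iff.rfl

lemma connected : (graph e).Connected := by
  have h1 : ∀ v, (graph e).Reachable (.inl 1) v := by
    have h0 : ∀ h, (graph e).Reachable (.inl 1) (.inl h) := by
      intro h
      by_cases hh : 1 = h
      · subst hh; exact SimpleGraph.Reachable.refl _
      · exact SimpleGraph.Adj.reachable ((adj_ll e _ _).2 hh)
    rintro (h | ⟨g, k⟩)
    · exact h0 h
    · refine (h0 (g * e.symm k)).trans (SimpleGraph.Adj.reachable ((adj_lr e _ _).2 ?_))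
      simp
  haveI : Nonempty (Γ ⊕ (Γ × Fin (m + 1))) := ⟨.inl 1⟩
  exact SimpleGraph.Connected.mk fun u v => (h1 u).symm.trans (h1 v)

/-- Left multiplication. -/
def act (γ : Γ) : graph e ≃g graph e where
  toEquiv := Equiv.sumCongr (Equiv.mulLeft γ) ((Equiv.mulLeft γ).prodCongr (Equiv.refl _))
  map_rel_iff' := by
    rintro (g | c) (h | d) <;> simp [adj_ll, adj_lr, adj_rl, adj_rr, mul_assoc]

lemma act_l (γ h : Γ) : act e γ (.inl h) = .inl (γ * h) := rfl
lemma act_r (γ g : Γ) (k) : act e γ (.inr (g, k)) = .inr (γ * g, k) := rfl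

def actHom : Γ →* (graph e ≃g graph e) where
  toFun := act e
  map_one' := by
    ext v
    rcases v with h | ⟨g, k⟩
    · rw [act_l, one_mul]; rfl
    · rw [act_r, one_mul]; rfl
  map_mul' a b := by
    ext v
    rcases v with h | ⟨g, k⟩
    · rw [act_l, mul_assoc]; rfl
    · rw [act_r, mul_assoc]; rfl

open Classical in
lemma degree_r [Fintype Γ] (g : Γ) (k : Fin (m + 1)) :
    (graph e).degree (.inr (g, k)) = k + 1 + m := by
  have h : (graph e).neighborFinset (.inr (g, k)) =
      ((Finset.Iic k).map (e.symm.trans (Equiv.mulLeft g)).toEmbedding).disjSum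
        ({g} ×ˢ (Finset.univ.erase k)) := by
    ext v
    rcases v with h | ⟨g', k'⟩
    · simp only [SimpleGraph.mem_neighborFinset, adj_rl, Finset.inl_mem_disjSum, Finset.mem_map_equiv]
      simp
    · simp only [SimpleGraph.mem_neighborFinset, adj_rr, Finset.inr_mem_disjSum]
      simp [eq_comm]
      tauto
  rw [← SimpleGraph.card_neighborFinset_eq_degree, h, Finset.card_disjSum]
  simp

open Classical in
lemma degree_l [Fintype Γ] (hm : 0 < m) (h : Γ) :
    2 * m + 1 < (graph e).degree (.inl h) := by
  have hc : Fintype.card Γ = m + 1 := by simpa using Fintype.card_congr e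
  have H : (Finset.univ.erase h).disjSum
      (insert (h * (e.symm 0)⁻¹, 0) (Finset.univ ×ˢ {Fin.last m})) ⊆
      (graph e).neighborFinset (.inl h) := by
    intro v hv
    rcases v with h' | ⟨g', k'⟩
    · simp only [SimpleGraph.mem_neighborFinset, adj_ll]
      simp at hv
      exact Ne.symm hv
    · simp only [SimpleGraph.mem_neighborFinset, adj_lr]
      simp at hv
      rcases hv with ⟨rfl, rfl⟩ | rfl
      · simp
      · exact Fin.le_last _
  have := Finset.card_le_card H
  rw [SimpleGraph.card_neighborFinset_eq_degree, Finset.card_disjSum,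
    Finset.card_insert_of_notMem] at this
  · simp [hc] at this
    omega
  · simp [Fin.ext_iff]
    omega

lemma main (hm : 0 < m) (τ : graph e ≃g graph e) : ∃ γ, act e γ = τ := by
  classical
  haveI : Fintype Γ := Fintype.ofEquiv _ e.symm
  have hl : ∀ h, ∃ h', τ (.inl h) = .inl h' := by
    intro h
    rcases hx : τ (.inl h) with h' | ⟨g, k⟩
    · exact ⟨h', rfl⟩
    · have h1 := τ.degree_eq (.inl h)
      rw [hx, degree_r] at h1
      have := degree_l e hm h
      omega
  have hr : ∀ g k, ∃ g', τ (.inr (g, k)) = .inr (g', k) := by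
    intro g k
    have h1 := τ.degree_eq (.inr (g, k))
    rcases hx : τ (.inr (g, k)) with h' | ⟨g', k'⟩
    · rw [hx, degree_r] at h1
      have := degree_l e hm h'
      omega
    · rw [hx, degree_r, degree_r] at h1
      have : k' = k := by ext; omega
      exact ⟨g', by rw [this]⟩
  choose p hp using hl
  choose s hs using hr
  have hf : ∀ g k j, s g k = s g j := by
    intro g k j
    by_cases hkj : k = j
    · rw [hkj]
    · have : (graph e).Adj (.inr (g, k)) (.inr (g, j)) := (adj_rr e _ _).2 ⟨rfl, hkj⟩
      rw [← τ.map_adj_iff, hs, hs, adj_rr] at this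
      exact this.1
  have hrel : ∀ g h, (s g 0)⁻¹ * p h = g⁻¹ * h := by
    intro g h
    apply e.injective
    apply eq_of_forall_ge_iff
    intro k
    have := τ.map_adj_iff (v := .inl h) (w := .inr (g, k))
    rw [hp, hs, adj_lr, adj_lr, hf g k 0] at this
    exact this
  have hp' : ∀ h, p h = s 1 0 * h := by
    intro h
    have := hrel 1 h
    rw [inv_mul_eq_iff_eq_mul] at this
    simpa using this
  have hs' : ∀ g, s g 0 = s 1 0 * g := by
    intro g
    have := hrel g g
    rw [inv_mul_cancel, inv_mul_eq_one, hp'] at this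
    exact this
  refine ⟨s 1 0, ?_⟩
  ext v
  rcases v with h | ⟨g, k⟩
  · rw [act_l, hp, hp']
  · rw [act_r, hs, hf g k 0, hs' g]

end FruchtAux

/-- For every finite group `Γ`, there is a finite connected simple graph `G` and a
vertex `v ∈ V(G)` such that `Aut(G) ≅ Γ` and the stabilizer of `v` in `Aut(G)` is
trivial. -/
theorem exists_connected_with_trivial_stabilizer (Γ : Type) [Group Γ] [Finite Γ] :
    ∃ (V : Type) (_ : Fintype V) (G : SimpleGraph V) (v : V),
      G.Connected ∧
      Nonempty ((G ≃g G) ≃* Γ) ∧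
      ∀ τ : G ≃g G, τ v = v → τ = 1 := by
  classical
  rcases subsingleton_or_nontrivial Γ with hΓ | hΓ
  · have hs : ∀ τ : (⊥ : SimpleGraph Unit) ≃g (⊥ : SimpleGraph Unit), τ = 1 := by
      intro τ
      ext
    refine ⟨Unit, inferInstance, ⊥, (), ?_, ⟨?_⟩, fun τ _ => hs τ⟩
    · exact SimpleGraph.Connected.mk fun u v => by
        rw [Subsingleton.elim u v]
    · exact
        { toFun := fun _ => 1
          invFun := fun _ => 1
          left_inv := fun τ => (hs τ).symm
          right_inv := fun _ => Subsingleton.elim _ _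
          map_mul' := fun _ _ => Subsingleton.elim _ _ }
  · haveI : Fintype Γ := Fintype.ofFinite Γ
    obtain ⟨m, hm⟩ : ∃ m, Fintype.card Γ = m + 1 :=
      Nat.exists_eq_succ_of_ne_zero Fintype.card_ne_zero
    have h1 : 1 < Fintype.card Γ := Fintype.one_lt_card
    have hm0 : 0 < m := by omega
    let e : Γ ≃ Fin (m + 1) := Fintype.equivFinOfCardEq hm
    refine ⟨_, inferInstance, FruchtAux.graph e, .inl 1, FruchtAux.connected e, ⟨?_⟩, ?_⟩
    · refine (MulEquiv.ofBijective (FruchtAux.actHom e) ⟨?_, FruchtAux.main e hm0⟩).symm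
      intro a b hab
      have : FruchtAux.act e a (.inl 1) = FruchtAux.act e b (.inl 1) :=
        congrArg (fun τ : FruchtAux.graph e ≃g FruchtAux.graph e => τ (.inl 1)) hab
      rw [FruchtAux.act_l, FruchtAux.act_l] at this
      simpa using this
    · intro τ hτ
      obtain ⟨γ, rfl⟩ := FruchtAux.main e hm0 τ
      rw [FruchtAux.act_l] at hτ
      have : γ = 1 := by simpa using hτ
      rw [this]
      exact (FruchtAux.actHom e).map_one
end

section
/- For every finite group Γ, there exists a finite simple graph H and two vertices x, y ∈ V(H) such that: Aut(H) is the trivial group, the vertex-deleted subgraph H − x is connected, Aut(H − x) is isomorphic to Γ, and the stabilizer of y in Aut(H − x) is the trivial subgroup. -/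
namespace Gadget

/-- add a pendant vertex `none` attached to `y` -/
def pend {W : Type} (G : SimpleGraph W) (y : W) : SimpleGraph (Option W) where
  Adj a b := match a, b with
    | some u, some v => G.Adj u v
    | none, some v => v = y
    | some u, none => u = y
    | none, none => False
  symm := ⟨fun a b h => by
    cases a <;> cases b <;> simp_all [G.adj_comm]⟩
  loopless := ⟨fun a h => by cases a <;> simp_all⟩

def pendIso {W : Type} (G : SimpleGraph W) (y : W) :
    G ≃g (pend G y).induce ({none}ᶜ : Set (Option W)) where
  toFun w := ⟨some w, by simp⟩
  invFun v := v.1.get (by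
    have := v.2
    simp only [Set.mem_compl_iff, Set.mem_singleton_iff] at this
    exact Option.isSome_iff_ne_none.2 this)
  left_inv w := by simp
  right_inv v := by ext; simp
  map_rel_iff' := by intro a b; simp [pend]

def autConj {V W : Type} {G : SimpleGraph V} {H : SimpleGraph W} (e : G ≃g H) :
    (H ≃g H) ≃* (G ≃g G) where
  toFun t := (e.trans t).trans e.symm
  invFun t := (e.symm.trans t).trans e
  left_inv t := by ext; simp
  right_inv t := by ext; simp
  map_mul' s t := by ext; simp

theorem main_of {Γ W : Type} [Group Γ] [Fintype W] (G : SimpleGraph W) (y : W)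
    (hc : G.Connected) (e : (G ≃g G) ≃* Γ) (hs : ∀ τ : G ≃g G, τ y = y → τ = 1)
    (h2 : ∀ w, ∃ a b, a ≠ b ∧ G.Adj w a ∧ G.Adj w b) :
    ∃ (V : Type) (_ : Fintype V) (H : SimpleGraph V) (x y : V)
      (hy : y ∈ ({x}ᶜ : Set V)),
      (∀ τ : H ≃g H, τ = 1) ∧
      (H.induce ({x}ᶜ : Set V)).Connected ∧
      Nonempty ((H.induce ({x}ᶜ : Set V) ≃g H.induce ({x}ᶜ : Set V)) ≃* Γ) ∧
      ∀ τ : H.induce ({x}ᶜ : Set V) ≃g H.induce ({x}ᶜ : Set V),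
        τ ⟨y, hy⟩ = ⟨y, hy⟩ → τ = 1 := by
  refine ⟨Option W, inferInstance, pend G y, none, some y, by simp, ?_, ?_, ?_, ?_⟩
  · intro τ
    have hn : τ none = none := by
      rcases h : τ none with _ | w
      · rfl
      · exfalso
        obtain ⟨a, b, hab, ha, hb⟩ := h2 w
        have key : ∀ c, G.Adj w c → τ.symm (some c) = some y := by
          intro c hc
          have h1 : (pend G y).Adj (τ.symm (some w)) (τ.symm (some c)) :=
            τ.symm.map_adj_iff.2 hc
          rw [← h, RelIso.symm_apply_apply] at h1
          rcases h3 : τ.symm (some c) with _ | v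
          · rw [h3] at h1; exact h1.elim
          · rw [h3] at h1; exact congrArg some h1
        have := (key a ha).trans (key b hb).symm
        exact hab (Option.some_injective _ (τ.symm.injective this))
    have hsome : ∀ w, ∃ v, τ (some w) = some v := by
      intro w
      rcases h : τ (some w) with _ | v
      · rw [← hn] at h; simpa using τ.injective h
      · exact ⟨v, rfl⟩
    have hsome' : ∀ w, ∃ v, τ.symm (some w) = some v := by
      intro w
      rcases h : τ.symm (some w) with _ | v
      · have := congrArg τ h
        rw [RelIso.apply_symm_apply, hn] at this; simp at this
      · exact ⟨v, rfl⟩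
    choose f hf using hsome
    choose f' hf' using hsome'
    let σ : G ≃g G :=
      { toFun := f
        invFun := f'
        left_inv := fun w => by
          apply Option.some_injective
          rw [← hf', ← hf, RelIso.symm_apply_apply]
        right_inv := fun w => by
          apply Option.some_injective
          rw [← hf, ← hf', RelIso.apply_symm_apply]
        map_rel_iff' := by
          intro a b
          have : (pend G y).Adj (τ (some a)) (τ (some b)) ↔ (pend G y).Adj (some a) (some b) :=
            τ.map_adj_iff
          rw [hf, hf] at this
          exact this }
    have hy : f y = y := by
      have : (pend G y).Adj (τ none) (τ (some y)) := τ.map_adj_iff.2 rfl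
      rw [hn, hf] at this
      exact this
    have hσ := hs σ hy
    ext1 a
    cases a with
    | none => exact hn
    | some w =>
      rw [hf]
      have : σ w = w := by rw [hσ]; rfl
      exact congrArg some this
  · exact (pendIso G y).connected_iff.1 hc
  · exact ⟨(autConj (pendIso G y)).trans e⟩
  · intro τ h
    have : autConj (pendIso G y) τ = 1 := by
      apply hs
      change (pendIso G y).symm (τ ((pendIso G y) y)) = y
      have h' : τ (pendIso G y y) = pendIso G y y := h
      rw [h', RelIso.symm_apply_apply]
    simpa using this

/-! the trivial group -/

def E6 : List (Fin 6 × Fin 6) := [(0, 1), (0, 2), (0, 3), (0, 5), (1, 2), (2, 3), (3, 4), (4, 5)]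

def G6 : SimpleGraph (Fin 6) where
  Adj a b := (a, b) ∈ E6 ∨ (b, a) ∈ E6
  symm := ⟨fun _ _ h => h.symm⟩
  loopless := ⟨by decide⟩

instance : DecidableRel G6.Adj := fun a b => inferInstanceAs (Decidable ((a, b) ∈ E6 ∨ (b, a) ∈ E6))

def wk (f : Fin 6 → ℕ) (v : Fin 6) : ℕ := ∑ w, if G6.Adj v w then f w else 0

theorem wk_inv (τ : G6 ≃g G6) (f : Fin 6 → ℕ) (hf : ∀ v, f (τ v) = f v) (v : Fin 6) :
    wk f (τ v) = wk f v := by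
  unfold wk
  rw [← Equiv.sum_comp τ.toEquiv]
  refine Finset.sum_congr rfl fun w _ => ?_
  have : G6.Adj (τ v) (τ w) ↔ G6.Adj v w := τ.map_adj_iff
  change (if G6.Adj (τ v) (τ w) then f (τ w) else 0) = _
  simp only [this, hf]

theorem G6_asym (τ : G6 ≃g G6) : τ = 1 := by
  have hinj : ∀ a b, wk (wk (wk (wk fun _ => 1))) a = wk (wk (wk (wk fun _ => 1))) b → a = b := by
    decide +kernel
  ext1 v
  exact hinj _ _ (wk_inv τ _ (wk_inv τ _ (wk_inv τ _ (wk_inv τ _ fun _ => rfl))) v)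

theorem G6_conn : G6.Connected := by
  have h : ∀ i : Fin 6, G6.Reachable 0 i := by
    have h1 : G6.Reachable 0 1 := SimpleGraph.Adj.reachable (by decide)
    have h2 : G6.Reachable 0 2 := SimpleGraph.Adj.reachable (by decide)
    have h3 : G6.Reachable 0 3 := SimpleGraph.Adj.reachable (by decide)
    have h5 : G6.Reachable 0 5 := SimpleGraph.Adj.reachable (by decide)
    have h4 : G6.Reachable 3 4 := SimpleGraph.Adj.reachable (by decide)
    intro i
    fin_cases i
    exacts [.refl _, h1, h2, h3, h3.trans h4, h5]
  exact ⟨fun a b => (h a).symm.trans (h b)⟩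

/-! the general construction -/

section
variable {Γ : Type} [Group Γ] {n : ℕ} (f : Fin (n + 3) → Γ)

def lab (i j : Fin (n + 3)) : Γ :=
  if i.1 = 1 ∧ 2 ≤ j.1 then f j else if j.1 = 1 ∧ 2 ≤ i.1 then (f i)⁻¹ else 1

theorem lab_inv (i j : Fin (n + 3)) : lab f j i = (lab f i j)⁻¹ := by
  unfold lab
  split_ifs <;> first | omega | simp

theorem lab_self (i : Fin (n + 3)) : lab f i i = 1 := by
  unfold lab
  split_ifs <;> first | omega | simp

def R (p q : Fin (n + 3) × Γ) : Prop := n + 3 ≤ p.1.1 + q.1.1 ∨ q.2 = p.2 * lab f p.1 q.1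

theorem R_refl (p : Fin (n + 3) × Γ) : R f p p := Or.inr (by simp [lab_self])

theorem R_symm {p q : Fin (n + 3) × Γ} (h : R f p q) : R f q p := by
  rcases h with h | h
  · left; omega
  · right; rw [lab_inv, h]; simp

def gr : SimpleGraph (Fin (n + 3) × Γ) where
  Adj p q := p ≠ q ∧ R f p q
  symm := ⟨fun _ _ h => ⟨h.1.symm, R_symm f h.2⟩⟩
  loopless := ⟨fun _ h => h.1 rfl⟩

theorem R_iff {p q : Fin (n + 3) × Γ} : R f p q ↔ p = q ∨ (gr f).Adj p q := by
  constructor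
  · intro h
    by_cases hpq : p = q
    · exact Or.inl hpq
    · exact Or.inr ⟨hpq, h⟩
  · rintro (rfl | h)
    · exact R_refl f _
    · exact h.2

theorem R_map (τ : gr f ≃g gr f) (p q : Fin (n + 3) × Γ) : R f (τ p) (τ q) ↔ R f p q := by
  rw [R_iff, R_iff, τ.map_adj_iff, τ.injective.eq_iff]

open Classical in
noncomputable def cnt [Fintype Γ] (p : Fin (n + 3) × Γ) : ℕ := ∑ q, if R f p q then 1 else 0

theorem cnt_map [Fintype Γ] (τ : gr f ≃g gr f) (p : Fin (n + 3) × Γ) :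
    cnt f (τ p) = cnt f p := by
  classical
  unfold cnt
  rw [← Equiv.sum_comp τ.toEquiv]
  refine Finset.sum_congr rfl fun w _ => ?_
  change (if R f (τ p) (τ w) then 1 else 0) = _
  simp only [R_map]

theorem cnt_eq [Fintype Γ] (p : Fin (n + 3) × Γ) :
    cnt f p = ∑ j : Fin (n + 3), if n + 3 ≤ p.1.1 + j.1 then Fintype.card Γ else 1 := by
  classical
  unfold cnt
  rw [Fintype.sum_prod_type]
  refine Finset.sum_congr rfl fun j _ => ?_
  by_cases h : n + 3 ≤ p.1.1 + j.1
  · simp [R, h]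
  · simp [R, h]

theorem cnt_lt [Fintype Γ] (hΓ : 1 < Fintype.card Γ) {p q : Fin (n + 3) × Γ} (h : p.1 < q.1) :
    cnt f p < cnt f q := by
  rw [cnt_eq, cnt_eq]
  have h' : p.1.1 < q.1.1 := h
  apply Finset.sum_lt_sum
  · intro j _
    split_ifs <;> omega
  · refine ⟨⟨n + 2 - p.1.1, by omega⟩, Finset.mem_univ _, ?_⟩
    have := p.1.2
    rw [if_neg (by simp only; omega), if_pos (by simp only; omega)]
    exact hΓ

theorem fst_map [Fintype Γ] (hΓ : 1 < Fintype.card Γ) (τ : gr f ≃g gr f)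
    (p : Fin (n + 3) × Γ) : (τ p).1 = p.1 := by
  have h := cnt_map f τ p
  rcases lt_trichotomy (τ p).1 p.1 with h1 | h1 | h1
  · have := cnt_lt f hΓ h1; omega
  · exact h1
  · have := cnt_lt f hΓ h1; omega

theorem snd_map [Fintype Γ] (hΓ : 1 < Fintype.card Γ) (τ : gr f ≃g gr f)
    (i j : Fin (n + 3)) (hij : i.1 + j.1 < n + 3) (g : Γ) :
    (τ (j, g * lab f i j)).2 = (τ (i, g)).2 * lab f i j := by
  have h : R f (i, g) (j, g * lab f i j) := Or.inr rfl
  rw [← R_map f τ] at h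
  rcases h with h | h
  · rw [fst_map f hΓ, fst_map f hΓ] at h
    simp only at h; omega
  · rwa [fst_map f hΓ, fst_map f hΓ] at h

theorem aut_form [Fintype Γ] (hΓ : 1 < Fintype.card Γ)
    (hf : ∀ g : Γ, ∃ j : Fin (n + 3), 2 ≤ j.1 ∧ j.1 < n + 2 ∧ f j = g) (τ : gr f ≃g gr f)
    (p : Fin (n + 3) × Γ) : τ p = (p.1, (τ (0, 1)).2 * p.2) := by
  have h0 : ∀ j g, (τ (j, g)).2 = (τ (0, g)).2 := by
    intro j g
    have := snd_map f hΓ τ 0 j (by simp) g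
    have hl : lab f 0 j = 1 := by simp [lab]
    simpa [hl] using this
  have h1 : ∀ g, (τ (0, g)).2 = (τ (0, 1)).2 * g := by
    intro g
    obtain ⟨j, hj, hj', hg⟩ := hf g
    have := snd_map f hΓ τ 1 j (by simp; omega) 1
    have hl : lab f 1 j = g := by simp [lab, hj, hg]
    rw [hl, h0, h0 1, one_mul] at this
    exact this
  obtain ⟨i, g⟩ := p
  refine Prod.ext (fst_map f hΓ τ _) ?_
  rw [h0, h1]

def lm (γ : Γ) : gr f ≃g gr f where
  toFun p := (p.1, γ * p.2)
  invFun p := (p.1, γ⁻¹ * p.2)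
  left_inv p := by simp
  right_inv p := by simp
  map_rel_iff' := by
    intro p q
    simp [gr, R, mul_assoc, Prod.ext_iff]

def lmHom : Γ →* (gr f ≃g gr f) where
  toFun := lm f
  map_one' := by ext1 p; simp [lm]
  map_mul' a b := by
    ext1 p
    simp [lm, mul_assoc]

theorem lmHom_bij [Fintype Γ] (hΓ : 1 < Fintype.card Γ)
    (hf : ∀ g : Γ, ∃ j : Fin (n + 3), 2 ≤ j.1 ∧ j.1 < n + 2 ∧ f j = g) :
    Function.Bijective (lmHom f) := by
  constructor
  · intro a b h
    have := congrArg (fun t : gr f ≃g gr f => (t (0, 1)).2) h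
    simpa [lmHom, lm] using this
  · intro τ
    refine ⟨(τ (0, 1)).2, ?_⟩
    ext1 p
    exact (aut_form f hΓ hf τ p).symm

theorem gr_conn : (gr f).Connected := by
  have hR : ∀ {p q}, R f p q → (gr f).Reachable p q := by
    intro p q h
    rcases (R_iff f).1 h with rfl | h
    · exact .refl _
    · exact h.reachable
  have h0 : ∀ j g, (gr f).Reachable (0, g) (j, g) := fun j g => hR (Or.inr (by simp [lab]))
  have hl : ∀ g g', (gr f).Reachable (Fin.last _, g) (Fin.last _, g') := fun g g' =>
    hR (Or.inl (by simp; omega))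
  have : Nonempty (Fin (n + 3) × Γ) := ⟨(0, 1)⟩
  exact ⟨fun ⟨i, g⟩ ⟨j, g'⟩ => (h0 i g).symm.trans <| (h0 _ g).trans <| (hl g g').trans <|
    (h0 _ g').symm.trans (h0 j g')⟩

theorem gr_two (w : Fin (n + 3) × Γ) :
    ∃ a b, a ≠ b ∧ (gr f).Adj w a ∧ (gr f).Adj w b := by
  have key : ∀ j, j ≠ w.1 → (gr f).Adj w (j, w.2 * lab f w.1 j) := fun j hj =>
    ⟨fun h => hj (congrArg Prod.fst h).symm, Or.inr rfl⟩
  obtain ⟨j, k, hjk, hj, hk⟩ : ∃ j k : Fin (n + 3), j ≠ k ∧ j ≠ w.1 ∧ k ≠ w.1 := by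
    by_cases h0 : w.1.1 = 0
    · exact ⟨⟨1, by omega⟩, ⟨2, by omega⟩, by simp, by simp [Fin.ext_iff]; omega,
        by simp [Fin.ext_iff]; omega⟩
    · by_cases h1 : w.1.1 = 1
      · exact ⟨⟨0, by omega⟩, ⟨2, by omega⟩, by simp, by simp [Fin.ext_iff]; omega,
          by simp [Fin.ext_iff]; omega⟩
      · exact ⟨⟨0, by omega⟩, ⟨1, by omega⟩, by simp, by simp [Fin.ext_iff]; omega,
          by simp [Fin.ext_iff]; omega⟩
  exact ⟨_, _, fun h => hjk (congrArg Prod.fst h), key j hj, key k hk⟩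

end

end Gadget

/-- For every finite group `Γ`, there is a finite simple graph `H` and two vertices
`x, y ∈ V(H)` such that `Aut(H)` is trivial, `H - x` is connected,
`Aut(H - x) ≅ Γ`, and the stabilizer of `y` in `Aut(H - x)` is trivial. -/
theorem gadget_exists (Γ : Type) [Group Γ] [Finite Γ] :
    ∃ (V : Type) (_ : Fintype V) (H : SimpleGraph V) (x y : V)
      (hy : y ∈ ({x}ᶜ : Set V)),
      (∀ τ : H ≃g H, τ = 1) ∧
      (H.induce ({x}ᶜ : Set V)).Connected ∧
      Nonempty ((H.induce ({x}ᶜ : Set V) ≃g H.induce ({x}ᶜ : Set V)) ≃* Γ) ∧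
      ∀ τ : H.induce ({x}ᶜ : Set V) ≃g H.induce ({x}ᶜ : Set V),
        τ ⟨y, hy⟩ = ⟨y, hy⟩ → τ = 1 := by
  classical
  have := Fintype.ofFinite Γ
  by_cases hΓ : 1 < Fintype.card Γ
  · let e := Fintype.equivFin Γ
    let f : Fin (Fintype.card Γ + 3) → Γ := fun j =>
      if h : j.1 - 2 < Fintype.card Γ then e.symm ⟨j.1 - 2, h⟩ else 1
    have hf : ∀ g : Γ, ∃ j : Fin (Fintype.card Γ + 3),
        2 ≤ j.1 ∧ j.1 < Fintype.card Γ + 2 ∧ f j = g := by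
      intro g
      have := (e g).2
      refine ⟨⟨(e g).1 + 2, by omega⟩, by simp, by simp, ?_⟩
      simp [f]
    refine Gadget.main_of (Gadget.gr f) (0, 1) (Gadget.gr_conn f)
      (MulEquiv.ofBijective _ (Gadget.lmHom_bij f hΓ hf)).symm ?_ (Gadget.gr_two f)
    intro τ h
    ext1 p
    rw [Gadget.aut_form f hΓ hf τ p, h]
    simp
  · have hs : Subsingleton Γ := Fintype.card_le_one_iff_subsingleton.1 (not_lt.1 hΓ)
    refine Gadget.main_of Gadget.G6 0 Gadget.G6_conn
      { toFun := fun _ => 1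
        invFun := fun _ => 1
        left_inv := fun t => (Gadget.G6_asym t).symm
        right_inv := fun t => Subsingleton.elim _ _
        map_mul' := fun _ _ => by simp } (fun τ _ => Gadget.G6_asym τ) (by decide +kernel)
end

section
/- For every k ≥ 1 and all finite groups Γ₀, Γ₁, …, Γ_k, there exists a finite simple graph G with k distinct vertices v₁, …, v_k ∈ V(G) such that Aut(G) is isomorphic to Γ₀ and, for every i ∈ {1, …, k}, Aut(G − v_i) is isomorphic to Γ_i. -/
namespace SD

inductive EV (V C : Type) : Type
  | v (x : V) : EV V C
  | r (j : C) : EV V C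
  | h : EV V C
  | l : EV V C

theorem finite_EV (V C : Type) [Finite V] [Finite C] : Finite (EV V C) := by
  let f : V ⊕ C ⊕ Bool → EV V C := fun s => match s with
    | Sum.inl x => EV.v x
    | Sum.inr (Sum.inl j) => EV.r j
    | Sum.inr (Sum.inr true) => EV.h
    | Sum.inr (Sum.inr false) => EV.l
  refine Finite.of_surjective f ?_
  intro a
  cases a with
  | v x => exact ⟨Sum.inl x, rfl⟩
  | r j => exact ⟨Sum.inr (Sum.inl j), rfl⟩
  | h => exact ⟨Sum.inr (Sum.inr true), rfl⟩
  | l => exact ⟨Sum.inr (Sum.inr false), rfl⟩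

def EV.map {V V' C : Type} (f : V → V') : EV V C → EV V' C
  | .v x => .v (f x)
  | .r j => .r j
  | .h => .h
  | .l => .l

def extAdj {V C : Type} [LE C] (H : SimpleGraph V) (col : V → C) : EV V C → EV V C → Prop
  | .v x, .v y => H.Adj x y
  | .v x, .r j => j ≤ col x
  | .r j, .v x => j ≤ col x
  | .r _, .h => True
  | .h, .r _ => True
  | .h, .l => True
  | .l, .h => True
  | _, _ => False

def ext {V C : Type} [LE C] (H : SimpleGraph V) (col : V → C) : SimpleGraph (EV V C) where
  Adj := extAdj H col
  symm := ⟨by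
    intro a b hab
    cases a <;> cases b <;> simp_all [extAdj]
    exact hab.symm⟩
  loopless := ⟨by
    intro a ha
    cases a <;> simp_all [extAdj]⟩

theorem ext_adj {V C : Type} [LE C] (H : SimpleGraph V) (col : V → C) (a b : EV V C) :
    (ext H col).Adj a b ↔ extAdj H col a b := Iff.rfl

def colAut {V C : Type} (H : SimpleGraph V) (col : V → C) : Subgroup (Equiv.Perm V) where
  carrier := {φ | (∀ x y, H.Adj (φ x) (φ y) ↔ H.Adj x y) ∧ ∀ x, col (φ x) = col x}
  one_mem' := by simp
  mul_mem' := by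
    rintro a b ⟨h1, h2⟩ ⟨h3, h4⟩
    simp [h1, h2, h3, h4]
  inv_mem' := by
    rintro a ⟨h1, h2⟩
    refine ⟨fun x y => ?_, fun x => ?_⟩
    · rw [← h1]; simp
    · rw [← h2]; simp

def extHom {V C : Type} [LE C] (H : SimpleGraph V) (col : V → C) :
    colAut H col →* (ext H col ≃g ext H col) where
  toFun φ :=
    { toFun := EV.map φ.1
      invFun := EV.map φ.1.symm
      left_inv := by intro a; cases a <;> simp [EV.map]
      right_inv := by intro a; cases a <;> simp [EV.map]
      map_rel_iff' := by
        obtain ⟨φ, h1, h2⟩ := φ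
        intro a b
        cases a <;> cases b <;> simp [EV.map, ext_adj, extAdj, h1, h2] }
  map_one' := by
    ext a; cases a <;> simp [EV.map]
  map_mul' := by
    intro f g
    ext a; cases a <;> simp [EV.map]

theorem extHom_apply {V C : Type} [LE C] (H : SimpleGraph V) (col : V → C)
    (φ : colAut H col) (a : EV V C) : extHom H col φ a = EV.map φ.1 a := rfl

section
variable {V C : Type} [LinearOrder C] {H : SimpleGraph V} {col : V → C}

theorem fix_l [Nonempty C] (hH : ∀ x, ∃ y, H.Adj x y) (hc : Function.Surjective col)
    (σ : ext H col ≃g ext H col) : σ .l = .l := by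
  have key : ∀ u w, (ext H col).Adj (σ .l) u → (ext H col).Adj (σ .l) w → u = w := by
    intro u w hu hw
    have h1 : (ext H col).Adj .l (σ.symm u) := by
      rw [← σ.map_adj_iff]; simpa using hu
    have h2 : (ext H col).Adj .l (σ.symm w) := by
      rw [← σ.map_adj_iff]; simpa using hw
    apply σ.symm.injective
    revert h1 h2
    generalize σ.symm u = a
    generalize σ.symm w = b
    intro h1 h2
    cases a <;> cases b <;> simp_all [ext_adj, extAdj]
  revert key
  generalize σ .l = a
  intro key
  cases a with
  | v x =>
    obtain ⟨y, hy⟩ := hH x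
    have := key (.v y) (.r (col x)) hy (le_refl (col x))
    cases this
  | r j =>
    obtain ⟨x, rfl⟩ := hc j
    have := key (.v x) .h (le_refl (col x)) trivial
    cases this
  | h =>
    obtain ⟨j⟩ := ‹Nonempty C›
    have := key (.r j) .l trivial trivial
    cases this
  | l => rfl

theorem fix_h [Nonempty C] (hH : ∀ x, ∃ y, H.Adj x y) (hc : Function.Surjective col)
    (σ : ext H col ≃g ext H col) : σ .h = .h := by
  have h1 : (ext H col).Adj (σ .l) (σ .h) := by
    rw [σ.map_adj_iff]; trivial
  rw [fix_l hH hc] at h1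
  revert h1
  generalize σ .h = a
  intro h1
  cases a <;> simp_all [ext_adj, extAdj]

theorem fix_r [Nonempty C] (hH : ∀ x, ∃ y, H.Adj x y) (hc : Function.Surjective col)
    (σ : ext H col ≃g ext H col) (j : C) : ∃ j', σ (.r j) = .r j' := by
  have h1 : (ext H col).Adj (σ .h) (σ (.r j)) := by
    rw [σ.map_adj_iff]; trivial
  have h2 : σ (.r j) ≠ σ .l := fun h => by cases σ.injective h
  rw [fix_h hH hc] at h1
  rw [fix_l hH hc] at h2
  revert h1 h2
  generalize σ (.r j) = a
  intro h1 h2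
  cases a <;> simp_all [ext_adj, extAdj]

theorem fix_v [Nonempty C] (hH : ∀ x, ∃ y, H.Adj x y) (hc : Function.Surjective col)
    (σ : ext H col ≃g ext H col) (x : V) : ∃ y, σ (.v x) = .v y := by
  have h1 : ¬ (ext H col).Adj (σ .h) (σ (.v x)) := by
    rw [σ.map_adj_iff]; exact fun h => h
  have h2 : σ (.v x) ≠ σ .l := fun h => by cases σ.injective h
  have h3 : σ (.v x) ≠ σ .h := fun h => by cases σ.injective h
  rw [fix_h hH hc] at h1 h3
  rw [fix_l hH hc] at h2
  revert h1 h2 h3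
  generalize σ (.v x) = a
  intro h1 h2 h3
  cases a <;> simp_all [ext_adj, extAdj]

theorem extHom_bij [WellFoundedLT C] [Nonempty C] (hH : ∀ x, ∃ y, H.Adj x y)
    (hc : Function.Surjective col) : Function.Bijective (extHom H col) := by
  constructor
  · intro φ ψ h
    apply Subtype.ext
    ext x
    have := congrArg (fun s : ext H col ≃g ext H col => s (.v x)) h
    simp only [extHom_apply, EV.map] at this
    injection this
  · intro σ
    choose τ hτ using fix_v hH hc σ
    choose τ' hτ' using fix_v hH hc σ.symm
    have mono : ∀ (σ : ext H col ≃g ext H col) (π : C → C), (∀ j, σ (.r j) = .r (π j)) →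
        StrictMono π := by
      intro σ π hπ
      choose τ hτ using fix_v hH hc σ
      choose τ' hτ' using fix_v hH hc σ.symm
      have e : ∀ j x, π j ≤ col (τ x) ↔ j ≤ col x := by
        intro j x
        have := σ.map_adj_iff (v := .r j) (w := .v x)
        rw [hπ, hτ] at this
        exact this
      intro i j hij
      by_contra hcon
      push Not at hcon
      obtain ⟨x, rfl⟩ := hc i
      have := (e (col x) x).2 le_rfl
      have := (e j x).1 (hcon.trans this)
      exact absurd hij (not_lt.2 this)
    choose π hπ using fix_r hH hc σ
    choose π' hπ' using fix_r hH hc σ.symm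
    have m1 := mono σ π hπ
    have m2 := mono σ.symm π' hπ'
    have hid : ∀ j, π j = j := by
      intro j
      have a1 : j ≤ π j := m1.le_apply
      have a2 : π j ≤ π' (π j) := m2.le_apply
      have : (EV.r (π' (π j)) : EV V C) = .r j := by
        rw [← hπ', ← hπ]; simp
      injection this with this
      rw [this] at a2
      exact le_antisymm a2 a1
    have l1 : ∀ x, τ' (τ x) = x := by
      intro x
      have : (EV.v (τ' (τ x)) : EV V C) = .v x := by
        rw [← hτ', ← hτ]; simp
      injection this
    have l2 : ∀ x, τ (τ' x) = x := by
      intro x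
      have : (EV.v (τ (τ' x)) : EV V C) = .v x := by
        rw [← hτ, ← hτ']; simp
      injection this
    have e : ∀ j x, j ≤ col (τ x) ↔ j ≤ col x := by
      intro j x
      have := σ.map_adj_iff (v := .r j) (w := .v x)
      rw [hπ, hτ, hid] at this
      exact this
    refine ⟨⟨⟨τ, τ', l1, l2⟩, ?_, ?_⟩, ?_⟩
    · intro x y
      have := σ.map_adj_iff (v := .v x) (w := .v y)
      rw [hτ, hτ] at this
      exact this
    · intro x
      exact le_antisymm ((e _ _).1 le_rfl) ((e _ _).2 le_rfl)
    · ext a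
      rw [extHom_apply]
      cases a with
      | v x => exact (hτ x).symm
      | r j => simp [EV.map, hπ, hid]
      | h => simp [EV.map, fix_h hH hc]
      | l => simp [EV.map, fix_l hH hc]

end

/-- conjugation of automorphism groups -/
def autCongr {V W : Type} {G : SimpleGraph V} {K : SimpleGraph W} (e : G ≃g K) :
    (G ≃g G) ≃* (K ≃g K) where
  toFun s := (e.symm.trans s).trans e
  invFun s := (e.trans s).trans e.symm
  left_inv s := by ext a; simp
  right_inv s := by ext a; simp
  map_mul' s t := by ext a; simp

theorem ext_del {V V' C : Type} [LE C] (H : SimpleGraph V) (col : V → C) (H' : SimpleGraph V')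
    (col' : V' → C) (v : V) (f : V' → V) (hf : Function.Injective f)
    (hr : ∀ x, x ≠ v ↔ ∃ y, f y = x) (hH : ∀ x y, H.Adj (f x) (f y) ↔ H'.Adj x y)
    (hcol : ∀ x, col (f x) = col' x) :
    Nonempty (ext H' col' ≃g (ext H col).induce ({EV.v v}ᶜ : Set (EV V C))) := by
  have hm : ∀ a : EV V' C, EV.map f a ∈ ({EV.v v}ᶜ : Set (EV V C)) := by
    intro a
    cases a <;> simp [EV.map]
    exact (hr _).2 ⟨_, rfl⟩
  have hb : Function.Bijective
      (fun a : EV V' C => (⟨EV.map f a, hm a⟩ : ({EV.v v}ᶜ : Set (EV V C)))) := by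
    constructor
    · intro a b hab
      have := congrArg Subtype.val hab
      cases a <;> cases b <;> simp_all [EV.map, hf.eq_iff]
    · rintro ⟨a, ha⟩
      cases a with
      | v x =>
        have : x ≠ v := by rintro rfl; exact ha rfl
        obtain ⟨y, rfl⟩ := (hr x).1 this
        exact ⟨.v y, rfl⟩
      | r j => exact ⟨.r j, rfl⟩
      | h => exact ⟨.h, rfl⟩
      | l => exact ⟨.l, rfl⟩
  refine ⟨⟨Equiv.ofBijective _ hb, ?_⟩⟩
  intro a b
  simp only [Equiv.ofBijective_apply, SimpleGraph.comap_adj, Function.Embedding.subtype_apply]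
  cases a <;> cases b <;> simp [EV.map, ext_adj, extAdj, hH, hcol]

/-! Relational structures -/

def autR {X T : Type} (R : T → X → X → Prop) (M : Set X) : Subgroup (Equiv.Perm X) where
  carrier := {φ | (∀ t x y, R t (φ x) (φ y) ↔ R t x y) ∧ ∀ x, φ x ∈ M ↔ x ∈ M}
  one_mem' := by simp
  mul_mem' := by
    rintro a b ⟨h1, h2⟩ ⟨h3, h4⟩
    simp [h1, h2, h3, h4]
  inv_mem' := by
    rintro a ⟨h1, h2⟩
    refine ⟨fun t x y => ?_, fun x => ?_⟩
    · rw [← h1]; simp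
    · rw [← h2]; simp

inductive Lay (T : Type) : Type
  | s : Lay T
  | d : Lay T
  | m : Lay T
  | t (a : T) : Lay T

theorem finite_Lay (T : Type) [Finite T] : Finite (Lay T) := by
  let f : Option (Option (Option T)) → Lay T := fun s => match s with
    | none => .s
    | some none => .d
    | some (some none) => .m
    | some (some (some a)) => .t a
  refine Finite.of_surjective f ?_
  intro a
  cases a with
  | s => exact ⟨none, rfl⟩
  | d => exact ⟨some none, rfl⟩
  | m => exact ⟨some (some none), rfl⟩
  | t a => exact ⟨some (some (some a)), rfl⟩

abbrev HV {X : Type} (T : Type) (M : Set X) : Type := {p : X × Lay T // p.2 = .m → p.1 ∈ M}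

def hAdj {X T : Type} (R : T → X → X → Prop) (x y : X) : Lay T → Lay T → Prop
  | .s, .s => False
  | .s, _ => x = y
  | _, .s => x = y
  | .t a, .d => R a x y
  | .d, .t a => R a y x
  | _, _ => False

def HG {X T : Type} (R : T → X → X → Prop) (M : Set X) : SimpleGraph (HV T M) where
  Adj p q := hAdj R p.1.1 q.1.1 p.1.2 q.1.2
  symm := ⟨by
    rintro ⟨⟨x, a⟩, _⟩ ⟨⟨y, b⟩, _⟩ hab
    cases a <;> cases b <;> simp_all [hAdj]⟩
  loopless := ⟨by
    rintro ⟨⟨x, a⟩, _⟩ ha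
    cases a <;> simp_all [hAdj]⟩

theorem HG_adj {X T : Type} (R : T → X → X → Prop) (M : Set X) (p q : HV T M) :
    (HG R M).Adj p q ↔ hAdj R p.1.1 q.1.1 p.1.2 q.1.2 := Iff.rfl

theorem HG_nbr {X T : Type} (R : T → X → X → Prop) (M : Set X) (p : HV T M) :
    ∃ q, (HG R M).Adj p q := by
  obtain ⟨⟨x, a⟩, hp⟩ := p
  cases a with
  | s => exact ⟨⟨(x, .d), by simp⟩, rfl⟩
  | d => exact ⟨⟨(x, .s), by simp⟩, rfl⟩
  | m => exact ⟨⟨(x, .s), by simp⟩, rfl⟩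
  | t a => exact ⟨⟨(x, .s), by simp⟩, rfl⟩

def hcol {X T C : Type} (M : Set X) (c : Lay T → C) (p : HV T M) : C := c p.1.2

theorem hcol_surj {X T C : Type} (M : Set X) (hM : M.Nonempty) (c : Lay T → C)
    (hc : Function.Surjective c) : Function.Surjective (hcol M c) := by
  intro j
  obtain ⟨a, rfl⟩ := hc j
  obtain ⟨x, hx⟩ := hM
  exact ⟨⟨(x, a), fun _ => hx⟩, rfl⟩

def hHom {X T C : Type} (R : T → X → X → Prop) (M : Set X) (c : Lay T → C) :
    autR R M →* colAut (HG R M) (hcol M c) where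
  toFun φ :=
    ⟨{ toFun := fun p => ⟨(φ.1 p.1.1, p.1.2), fun h => (φ.2.2 _).2 (p.2 h)⟩
       invFun := fun p => ⟨(φ.1.symm p.1.1, p.1.2), fun h => by
          have := (φ.2.2 (φ.1.symm p.1.1)).1
          simp only [Equiv.apply_symm_apply] at this
          exact this (p.2 h)⟩
       left_inv := by intro p; apply Subtype.ext; simp
       right_inv := by intro p; apply Subtype.ext; simp }, by
      constructor
      · obtain ⟨φ, h1, h2⟩ := φ
        rintro ⟨⟨x, a⟩, _⟩ ⟨⟨y, b⟩, _⟩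
        change hAdj R (φ x) (φ y) a b ↔ hAdj R x y a b
        cases a <;> cases b <;> simp [hAdj, h1]
      · intro x; rfl⟩
  map_one' := by
    apply Subtype.ext; apply Equiv.ext; intro p; rfl
  map_mul' := by
    intro f g
    apply Subtype.ext; apply Equiv.ext; intro p; rfl

theorem hHom_apply {X T C : Type} (R : T → X → X → Prop) (M : Set X) (c : Lay T → C)
    (φ : autR R M) (p : HV T M) : ((hHom R M c φ).1 p).1 = (φ.1 p.1.1, p.1.2) := rfl

theorem hHom_bij {X T C : Type} (R : T → X → X → Prop) (M : Set X) (c : Lay T → C)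
    (hc : Function.Injective c) : Function.Bijective (hHom R M c) := by
  constructor
  · intro φ ψ h
    apply Subtype.ext
    ext x
    have := congrArg (fun s : colAut (HG R M) (hcol M c) =>
      (s.1 ⟨(x, .s), by simp⟩).1.1) h
    exact this
  · rintro ⟨ψ, h1, h2⟩
    have hl : ∀ p, (ψ p).1.2 = p.1.2 := fun p => hc (h2 p)
    let S : X → HV T M := fun x => ⟨(x, .s), by simp⟩
    have hS : ∀ p, (ψ p).1.1 = (ψ (S p.1.1)).1.1 := by
      intro p
      by_cases hp : p.1.2 = .s
      · congr 2
        exact congrArg ψ (Subtype.ext (Prod.ext rfl hp))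
      · have : (HG R M).Adj (S p.1.1) p := by
          obtain ⟨⟨x, a⟩, hpa⟩ := p
          cases a with
          | s => exact absurd rfl hp
          | d => exact rfl
          | m => exact rfl
          | t b => exact rfl
        rw [← h1, HG_adj, hl, hl] at this
        revert this
        generalize (ψ p).1.1 = u
        generalize (ψ (S p.1.1)).1.1 = w
        obtain ⟨⟨x, a⟩, _⟩ := p
        cases a <;> simp_all [hAdj, S]
    have hSS : ∀ x, ψ (S x) = S (ψ (S x)).1.1 := by
      intro x
      exact Subtype.ext (Prod.ext rfl (hl _))
    have h2' : ∀ p, (ψ.symm p).1.2 = p.1.2 := by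
      intro p
      rw [← hl]; simp
    have hSS' : ∀ x, ψ.symm (S x) = S (ψ.symm (S x)).1.1 := by
      intro x
      exact Subtype.ext (Prod.ext rfl (h2' _))
    let φ : Equiv.Perm X :=
      { toFun := fun x => (ψ (S x)).1.1
        invFun := fun x => (ψ.symm (S x)).1.1
        left_inv := by
          intro x
          simp only [← hSS, Equiv.symm_apply_apply]
          rfl
        right_inv := by
          intro x
          simp only [← hSS', Equiv.apply_symm_apply]
          rfl }
    have hφ : ∀ p, (ψ p).1 = (φ p.1.1, p.1.2) := fun p => Prod.ext (hS p) (hl p)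
    refine ⟨⟨φ, ?_, ?_⟩, ?_⟩
    · intro t x y
      have := h1 ⟨(x, .t t), by simp⟩ ⟨(y, .d), by simp⟩
      rw [HG_adj, HG_adj, hφ, hφ] at this
      exact this
    · intro x
      constructor
      · intro hx
        let q : HV T M := ⟨(φ x, .m), fun _ => hx⟩
        have e1 := hφ (ψ.symm q)
        rw [Equiv.apply_symm_apply] at e1
        have e2 := congrArg (fun p : X × Lay T => p.1) e1
        have e3 : x = (ψ.symm q).1.1 := φ.injective e2
        rw [e3]
        exact (ψ.symm q).2 (h2' q)
      · intro hx
        have := (ψ ⟨(x, .m), fun _ => hx⟩).2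
        rw [hφ] at this
        exact this rfl
    · apply Subtype.ext
      apply Equiv.ext
      intro p
      apply Subtype.ext
      rw [hHom_apply, hφ]

theorem struct_to_graph {X T : Type} [Finite X] [Finite T] (R : T → X → X → Prop) (M : Set X)
    {k : ℕ} (m : Fin k → X) (hm : Function.Injective m) (hmM : ∀ i, m i ∈ M)
    (hne : ∀ i, (M \ {m i}).Nonempty) (hM : M.Nonempty) :
    ∃ (V : Type) (_ : Fintype V) (G : SimpleGraph V) (v : Fin k → V),
      Function.Injective v ∧
      Nonempty ((G ≃g G) ≃* autR R M) ∧
      ∀ i : Fin k,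
        Nonempty ((G.induce ({v i}ᶜ : Set V) ≃g G.induce ({v i}ᶜ : Set V)) ≃*
          autR R (M \ {m i})) := by
  have := finite_Lay T
  obtain ⟨n, ⟨c⟩⟩ := Finite.exists_equiv_fin (Lay T)
  have : Nonempty (Fin n) := ⟨c .s⟩
  have : Finite (HV T M) := inferInstance
  have := finite_EV (HV T M) (Fin n)
  have key : ∀ N : Set X, N.Nonempty →
      Nonempty ((ext (HG R N) (hcol N c) ≃g ext (HG R N) (hcol N c)) ≃* autR R N) := by
    intro N hN
    exact ⟨((MulEquiv.ofBijective _ (hHom_bij R N c c.injective)).trans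
      (MulEquiv.ofBijective _ (extHom_bij (HG_nbr R N) (hcol_surj N hN c c.surjective)))).symm⟩
  let w : Fin k → HV T M := fun i => ⟨(m i, .m), fun _ => hmM i⟩
  refine ⟨EV (HV T M) (Fin n), Fintype.ofFinite _, ext (HG R M) (hcol M c),
    fun i => .v (w i), ?_, key M hM, ?_⟩
  · intro i j hij
    injection hij with hij
    exact hm (congrArg (fun p : HV T M => p.1.1) hij)
  · intro i
    obtain ⟨e⟩ := key (M \ {m i}) (hne i)
    let f : HV T (M \ {m i}) → HV T M := fun p => ⟨p.1, fun h => (p.2 h).1⟩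
    obtain ⟨d⟩ := ext_del (HG R M) (hcol M c) (HG R (M \ {m i})) (hcol _ c) (w i) f
      (by
        intro p q hpq
        exact Subtype.ext (congrArg (fun p : HV T M => p.1) hpq))
      (by
        intro p
        constructor
        · intro hp
          refine ⟨⟨p.1, fun h => ⟨p.2 h, ?_⟩⟩, rfl⟩
          intro h'
          exact hp (Subtype.ext (Prod.ext h' h))
        · rintro ⟨q, rfl⟩ h
          have h3 : q.1 = (m i, .m) := congrArg (fun p : HV T M => p.1) h
          have := (q.2 (by rw [h3])).2
          rw [h3] at this
          exact this rfl)
      (fun _ _ => Iff.rfl) (fun _ => rfl)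
    exact ⟨(autCongr d).symm.trans e⟩

/-! The structure -/

section
variable {I : Type} (Δ : Type) [Group Δ] (Γ : I → Type) [∀ i, Group (Γ i)]

abbrev SX : Type := Δ × (Σ i, Γ i)

abbrev ST : Type := Δ ⊕ (Σ i, Γ i)

def SR : ST Δ Γ → SX Δ Γ → SX Δ Γ → Prop
  | .inl γ, x, y => y.1 = x.1 * γ
  | .inr ⟨i, a⟩, x, y => x.1 = y.1 ∧ ∃ h : Γ i, x.2 = ⟨i, h⟩ ∧ y.2 = ⟨i, h * a⟩

def SM : Set (SX Δ Γ) := {x | x.2.2 = 1}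

variable {Δ Γ}

theorem form (φ : Equiv.Perm (SX Δ Γ)) (h : ∀ t x y, SR Δ Γ t (φ x) (φ y) ↔ SR Δ Γ t x y)
    [Nonempty I] :
    ∃ (c : Δ) (u : Δ → ∀ i, Γ i), ∀ g i a, φ (g, ⟨i, a⟩) = (c * g, ⟨i, u g i * a⟩) := by
  obtain ⟨i0⟩ := ‹Nonempty I›
  have hc : ∀ x, (φ x).1 = (φ (1, ⟨i0, 1⟩)).1 * x.1 := by
    intro x
    have := (h (.inl x.1) (1, ⟨i0, 1⟩) x).2 (by simp [SR])
    simpa [SR] using this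
  have hi : ∀ g i a, ∃ b : Γ i, (φ (g, ⟨i, a⟩)).2 = ⟨i, b⟩ := by
    intro g i a
    have := (h (.inr ⟨i, 1⟩) (g, ⟨i, a⟩) (g, ⟨i, a⟩)).2 ⟨rfl, a, rfl, by simp⟩
    obtain ⟨_, b, hb, _⟩ := this
    exact ⟨b, hb⟩
  choose b hb using hi
  refine ⟨(φ (1, ⟨i0, 1⟩)).1, fun g i => b g i 1, ?_⟩
  intro g i a
  refine Prod.ext (hc _) ?_
  have := (h (.inr ⟨i, a⟩) (g, ⟨i, 1⟩) (g, ⟨i, a⟩)).2 ⟨rfl, 1, rfl, by simp⟩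
  obtain ⟨_, b', hb1, hb2⟩ := this
  rw [hb] at hb1
  rw [hb2]
  simp at hb1
  simp [hb1]

/-- the action of `Δ` -/
def hom0 : Δ →* autR (SR Δ Γ) (SM Δ Γ) where
  toFun c := ⟨(Equiv.mulLeft c).prodCongr (Equiv.refl _), by
    constructor
    · rintro (γ | ⟨i, a⟩) x y
      · simp [SR, mul_assoc]
      · simp [SR]
    · intro x; simp [SM]⟩
  map_one' := by apply Subtype.ext; apply Equiv.ext; rintro ⟨g, x⟩; simp
  map_mul' c d := by apply Subtype.ext; apply Equiv.ext; rintro ⟨g, x⟩; simp [mul_assoc]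

theorem hom0_bij [Nonempty I] : Function.Bijective (hom0 (Δ := Δ) (Γ := Γ)) := by
  constructor
  · intro c d h
    obtain ⟨i0⟩ := ‹Nonempty I›
    have := congrArg (fun s : autR (SR Δ Γ) (SM Δ Γ) => (s.1 (1, ⟨i0, 1⟩)).1) h
    simpa [hom0] using this
  · rintro ⟨φ, h1, h2⟩
    obtain ⟨c, u, hu⟩ := form φ h1
    refine ⟨c, Subtype.ext ?_⟩
    apply Equiv.ext
    rintro ⟨g, i, a⟩
    have : u g i = 1 := by
      have := (h2 (g, ⟨i, 1⟩)).2 rfl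
      rw [hu] at this
      simpa [SM] using this
    rw [hu, this]
    simp [hom0]

variable [DecidableEq I] [DecidableEq Δ]

/-- local multiplication at `(1, j)` -/
def loc (j : I) (u : Γ j) (x : SX Δ Γ) : SX Δ Γ :=
  if x.1 = 1 then (x.1, ⟨x.2.1, (Pi.mulSingle j u : ∀ i, Γ i) x.2.1 * x.2.2⟩) else x

theorem loc_mul (j : I) (u v : Γ j) (x : SX Δ Γ) : loc j (u * v) x = loc j u (loc j v x) := by
  obtain ⟨g, i, a⟩ := x
  by_cases h : g = 1
  · subst h
    have e : ∀ (w : Γ j) (b : Γ i), loc j w ((1, ⟨i, b⟩) : SX Δ Γ) =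
        (1, ⟨i, (Pi.mulSingle j w : ∀ i, Γ i) i * b⟩) := fun w b => if_pos rfl
    rw [e, e, e, Pi.mulSingle_mul, Pi.mul_apply, mul_assoc]
  · simp [loc, h]

theorem loc_one (j : I) (x : SX Δ Γ) : loc j 1 x = x := by
  unfold loc
  by_cases h : x.1 = 1
  · obtain ⟨g, i, a⟩ := x
    simp_all
  · simp [h]

theorem loc_fst (j : I) (u : Γ j) (x : SX Δ Γ) : (loc j u x).1 = x.1 := by
  unfold loc
  split_ifs <;> rfl

theorem loc_rel (j : I) (u : Γ j) (t x y) (h : SR Δ Γ t x y) :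
    SR Δ Γ t (loc j u x) (loc j u y) := by
  obtain (γ | ⟨i, a⟩) := t
  · simpa [SR, loc_fst] using h
  · obtain ⟨h1, b, h2, h3⟩ := h
    obtain ⟨g, x2⟩ := x
    obtain ⟨g', y2⟩ := y
    simp only at h1 h2 h3
    subst h1 h2 h3
    refine ⟨by simp [loc_fst], ?_⟩
    by_cases hg : g = 1
    · refine ⟨(Pi.mulSingle j u : ∀ i, Γ i) i * b, ?_, ?_⟩ <;> simp [loc, hg, mul_assoc]
    · exact ⟨b, by simp [loc, hg], by simp [loc, hg]⟩

theorem loc_mem (j : I) (u : Γ j) (x) (h : x ∈ SM Δ Γ \ {(1, ⟨j, 1⟩)}) :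
    loc j u x ∈ SM Δ Γ \ {(1, ⟨j, 1⟩)} := by
  have : loc j u x = x := by
    obtain ⟨g, i, a⟩ := x
    obtain ⟨h1, h2⟩ := h
    have h1 : a = 1 := h1
    rw [h1] at h2 ⊢
    by_cases hg : g = 1
    · by_cases hi : i = j
      · subst hg hi
        exact absurd rfl h2
      · simp [loc, Pi.mulSingle_eq_of_ne hi]
    · simp [loc, hg]
  rw [this]; exact h

def homj (j : I) : Γ j →* autR (SR Δ Γ) (SM Δ Γ \ {(1, ⟨j, 1⟩)}) where
  toFun u := ⟨⟨loc j u, loc j u⁻¹, fun x => by rw [← loc_mul]; simp [loc_one],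
      fun x => by rw [← loc_mul]; simp [loc_one]⟩, by
    constructor
    · intro t x y
      refine ⟨fun h => ?_, loc_rel j u t x y⟩
      have := loc_rel j u⁻¹ _ _ _ h
      simpa [← loc_mul, loc_one] using this
    · intro x
      refine ⟨fun h => ?_, loc_mem j u x⟩
      have := loc_mem j u⁻¹ _ h
      simpa only [Equiv.coe_fn_mk, ← loc_mul, loc_one, inv_mul_cancel] using this⟩
  map_one' := by
    apply Subtype.ext; apply Equiv.ext; intro x; exact loc_one j x
  map_mul' u v := by
    apply Subtype.ext; apply Equiv.ext; intro x; exact loc_mul j u v x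

theorem homj_apply (j : I) (u : Γ j) (x : SX Δ Γ) : (homj j u).1 x = loc j u x := rfl

theorem homj_bij (j : I) : Function.Bijective (homj (Δ := Δ) (Γ := Γ) j) := by
  have : Nonempty I := ⟨j⟩
  constructor
  · intro u v h
    have := congrArg (fun s : autR (SR Δ Γ) (SM Δ Γ \ {(1, ⟨j, 1⟩)}) =>
      (s.1 (1, ⟨j, 1⟩))) h
    simpa [homj_apply, loc] using this
  · rintro ⟨φ, h1, h2⟩
    obtain ⟨c, u, hu⟩ := form φ h1
    have hne : ∀ g i, (g = 1 → ∀ e : i = j, False) → u g i = 1 ∧ (c * g = 1 → i ≠ j) := by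
      intro g i hgi
      have := (h2 (g, ⟨i, 1⟩)).2 ⟨rfl, by
        intro h
        have e1 : g = 1 := congrArg Prod.fst h
        have e2 : i = j := congrArg (fun p : SX Δ Γ => p.2.1) h
        exact hgi e1 e2⟩
      rw [hu] at this
      obtain ⟨t1, t2⟩ := this
      have t3 : u g i = 1 := by simpa [SM] using t1
      refine ⟨t3, ?_⟩
      rintro e rfl
      apply t2
      simp [e, t3]
    have hc : c = 1 := by
      by_contra hc
      have := (hne c⁻¹ j (by
        intro h _
        exact hc (inv_eq_one.1 h))).2 (by simp)
      exact this rfl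
    subst hc
    refine ⟨u 1 j, Subtype.ext ?_⟩
    apply Equiv.ext
    rintro ⟨g, i, a⟩
    rw [homj_apply]
    simp only [hu]
    by_cases hg : g = 1
    · by_cases hi : i = j
      · subst hg hi
        simp [loc]
      · rw [(hne g i (fun _ e => hi e)).1]
        simp [loc, Pi.mulSingle_eq_of_ne hi]
    · rw [(hne g i (fun e _ => hg e)).1]
      simp [loc, hg]

end

end SD

/-- **Single deletions.** For every `k ≥ 1` and all finite groups `Γ₀, Γ₁, …, Γₖ`,
there is a finite simple graph `G` with `k` distinct vertices `v₁, …, vₖ` such that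
`Aut(G) ≅ Γ₀` and `Aut(G - vᵢ) ≅ Γᵢ` for every `i ∈ {1, …, k}`. -/
theorem single_deletions (k : ℕ) (hk : 1 ≤ k) (Γ : Fin (k + 1) → Type)
    [∀ i, Group (Γ i)] [∀ i, Finite (Γ i)] :
    ∃ (V : Type) (_ : Fintype V) (G : SimpleGraph V) (v : Fin k → V),
      Function.Injective v ∧
      Nonempty ((G ≃g G) ≃* Γ 0) ∧
      ∀ i : Fin k,
        Nonempty ((G.induce ({v i}ᶜ : Set V) ≃g G.induce ({v i}ᶜ : Set V)) ≃* Γ i.succ) := by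
  classical
  obtain ⟨V, hV, G, v, hv, ⟨e0⟩, he⟩ := SD.struct_to_graph (SD.SR (Γ 0) Γ) (SD.SM (Γ 0) Γ)
    (fun i : Fin k => ((1, ⟨i.succ, 1⟩) : SD.SX (Γ 0) Γ))
    (by
      intro i j h
      have : i.succ = j.succ := congrArg (fun p : SD.SX (Γ 0) Γ => p.2.1) h
      exact Fin.succ_injective _ this)
    (fun i => rfl)
    (fun i => ⟨(1, ⟨0, 1⟩), rfl, by
      intro h
      have : (0 : Fin (k + 1)) = i.succ := congrArg (fun p : SD.SX (Γ 0) Γ => p.2.1) h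
      exact (Fin.succ_ne_zero i) this.symm⟩)
    ⟨(1, ⟨0, 1⟩), rfl⟩
  refine ⟨V, hV, G, v, hv, ⟨e0.trans (MulEquiv.ofBijective _ SD.hom0_bij).symm⟩, fun i => ?_⟩
  obtain ⟨e⟩ := he i
  exact ⟨e.trans (MulEquiv.ofBijective _ (SD.homj_bij i.succ)).symm⟩
end

section
/- For every k ≥ 1 and all finite groups Γ₀, Γ₁, …, Γ_k, there exists a finite simple graph G with k distinct vertices v₁, …, v_k ∈ V(G) such that Aut(G) is isomorphic to Γ₀ and, for every i ∈ {1, …, k}, the automorphism group of the iterated vertex-deleted subgraph G − v₁ − v₂ − ⋯ − v_i (the subgraph of G induced on V(G) \ {v₁, …, v_i}) is isomorphic to Γ_i. -/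
set_option linter.unusedSectionVars false

namespace IterDel

def CAut {V C : Type} (G : SimpleGraph V) (c : V → C) (D : Set V) : Subgroup (Equiv.Perm V) where
  carrier := {σ | (∀ x ∈ D, σ x = x) ∧
    (∀ x y, x ∉ D → y ∉ D → (G.Adj (σ x) (σ y) ↔ G.Adj x y)) ∧ ∀ x, c (σ x) = c x}
  one_mem' := by simp
  mul_mem' := by
    rintro σ τ ⟨h1, h2, h3⟩ ⟨k1, k2, k3⟩
    have hn : ∀ x, x ∉ D → τ x ∉ D := fun x hx h => hx (by
      have := τ.injective (k1 _ h); rwa [this] at h)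
    refine ⟨fun x hx => ?_, fun x y hx hy => ?_, fun x => ?_⟩
    · simp [k1 x hx, h1 x hx]
    · simp only [Equiv.Perm.coe_mul, Function.comp]
      rw [h2 _ _ (hn x hx) (hn y hy), k2 _ _ hx hy]
    · simp [h3, k3]
  inv_mem' := by
    rintro σ ⟨h1, h2, h3⟩
    have hn : ∀ x, x ∉ D → σ⁻¹ x ∉ D := fun x hx h => hx (by
      have := h1 _ h; rw [show σ (σ⁻¹ x) = x from σ.apply_symm_apply x] at this; rwa [← this] at h)
    refine ⟨fun x hx => ?_, fun x y hx hy => ?_, fun x => ?_⟩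
    · rw [Equiv.Perm.inv_eq_iff_eq, h1 x hx]
    · rw [← h2 _ _ (hn x hx) (hn y hy)]; simp
    · rw [← h3]; simp

section
variable {V C : Type} {G : SimpleGraph V} {c : V → C} {D : Set V}

theorem CAut.fix {σ : Equiv.Perm V} (h : σ ∈ CAut G c D) : ∀ x ∈ D, σ x = x := h.1
theorem CAut.adj {σ : Equiv.Perm V} (h : σ ∈ CAut G c D) :
    ∀ x y, x ∉ D → y ∉ D → (G.Adj (σ x) (σ y) ↔ G.Adj x y) := h.2.1
theorem CAut.col {σ : Equiv.Perm V} (h : σ ∈ CAut G c D) : ∀ x, c (σ x) = c x := h.2.2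
theorem CAut.nmem {σ : Equiv.Perm V} (h : σ ∈ CAut G c D) : ∀ x, x ∉ D → σ x ∉ D :=
  fun x hx h' => hx (by have := σ.injective (CAut.fix h _ h'); rwa [this] at h')

theorem CAut.of_fun [Finite V] (t : V → V) (ht : Function.Injective t)
    (h1 : ∀ x ∈ D, t x = x) (h2 : ∀ x y, x ∉ D → y ∉ D → (G.Adj (t x) (t y) ↔ G.Adj x y))
    (h3 : ∀ x, c (t x) = c x) : ∃ σ ∈ CAut G c D, ∀ x, σ x = t x :=
  ⟨Equiv.ofBijective t (Finite.injective_iff_bijective.mp ht), ⟨h1, h2, h3⟩, fun _ => rfl⟩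
end

inductive Y (Γ W : Type) : Type
  | a | b | u
  | m (s : Γ)
  | w (x : W)

instance {Γ W : Type} [Finite Γ] [Finite W] : Finite (Y Γ W) := by
  let f : (Fin 3 ⊕ Γ) ⊕ W → Y Γ W := fun z => match z with
    | .inl (.inl 0) => .a
    | .inl (.inl 1) => .b
    | .inl (.inl 2) => .u
    | .inl (.inr s) => .m s
    | .inr x => .w x
  apply Finite.of_surjective f
  rintro (_ | _ | _ | s | x)
  · exact ⟨.inl (.inl 0), rfl⟩
  · exact ⟨.inl (.inl 1), rfl⟩
  · exact ⟨.inl (.inl 2), rfl⟩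
  · exact ⟨.inl (.inr s), rfl⟩
  · exact ⟨.inr x, rfl⟩

def Y.map {Γ W C : Type} (c : W → C) : Y Γ W → Y Γ C
  | .a => .a
  | .b => .b
  | .u => .u
  | .m s => .m s
  | .w x => .w (c x)

section
variable {Γ W C : Type} [Group Γ]

def adj (H : SimpleGraph W) (r : W) : Γ × Y Γ W → Γ × Y Γ W → Prop
  | (_, .a), (_, .a) => False
  | (g, .a), (h, _) => g = h
  | (g, _), (h, .a) => g = h
  | (g, .m s), (h, .b) => g * s = h
  | (g, .b), (h, .m s) => h * s = g
  | (g, .u), (h, .w x) => g = h ∧ x = r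
  | (g, .w x), (h, .u) => g = h ∧ x = r
  | (g, .w x), (h, .w y) => g = h ∧ H.Adj x y
  | _, _ => False

def SG (Γ : Type) [Group Γ] (H : SimpleGraph W) (r : W) : SimpleGraph (Γ × Y Γ W) where
  Adj := adj H r
  symm := ⟨by
    rintro ⟨g, _ | _ | _ | s | x⟩ ⟨h, _ | _ | _ | t | y⟩ <;> simp [adj, eq_comm, H.adj_comm]⟩
  loopless := ⟨by
    rintro ⟨g, _ | _ | _ | s | x⟩ <;> simp [adj]⟩

def col (Γ : Type) (c : W → C) (p : Γ × Y Γ W) : Y Γ C := p.2.map c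

theorem adj_a {H : SimpleGraph W} {r : W} (g h : Γ) (y : Y Γ W) (hy : y ≠ .a) :
    (SG Γ H r).Adj (g, .a) (h, y) ↔ g = h := by
  change adj H r _ _ ↔ _
  cases y <;> first | exact absurd rfl hy | simp [adj]

theorem map_a {c : W → C} {y : Y Γ W} (h : y.map c = Y.a) : y = .a := by
  cases y <;> simp_all [Y.map]
theorem map_b {c : W → C} {y : Y Γ W} (h : y.map c = Y.b) : y = .b := by
  cases y <;> simp_all [Y.map]
theorem map_u {c : W → C} {y : Y Γ W} (h : y.map c = Y.u) : y = .u := by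
  cases y <;> simp_all [Y.map]
theorem map_m {c : W → C} {y : Y Γ W} {s : Γ} (h : y.map c = Y.m s) : y = .m s := by
  cases y <;> simp_all [Y.map]
theorem map_w {c : W → C} {y : Y Γ W} {k : C} (h : y.map c = Y.w k) : ∃ x, c x = k ∧ y = .w x := by
  cases y <;> simp_all [Y.map]

variable {H : SimpleGraph W} {r : W} {c : W → C} {D : Set (Γ × Y Γ W)}
  {φ : Equiv.Perm (Γ × Y Γ W)}

theorem base (hφ : φ ∈ CAut (SG Γ H r) (col Γ c) D)
    (hD : ∀ g y, (g, y) ∈ D → y = .u ∨ ∃ x, y = .w x) :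
    ∃ (h : Γ) (τ : Γ → W → W), (∀ g, φ (g, .a) = (h * g, .a)) ∧ (∀ g, φ (g, .b) = (h * g, .b)) ∧
      (∀ g s, φ (g, .m s) = (h * g, .m s)) ∧
      (∀ g, (φ (g, .u)).2 = .u) ∧ (∀ g, (g, .u) ∉ D → φ (g, .u) = (h * g, .u)) ∧
      (∀ g x, (φ (g, .w x)).2 = .w (τ g x)) ∧
      (∀ g x, (g, .w x) ∉ D → φ (g, .w x) = (h * g, .w (τ g x))) ∧
      (∀ g x, c (τ g x) = c x) := by
  have hc : ∀ p, (φ p).2.map c = p.2.map c := CAut.col hφ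
  have ha : ∀ g, (φ (g, .a)).2 = .a := fun g => map_a (hc _)
  have hb : ∀ g, (φ (g, .b)).2 = .b := fun g => map_b (hc _)
  have hu : ∀ g, (φ (g, .u)).2 = .u := fun g => map_u (hc _)
  have hm : ∀ g s, (φ (g, .m s)).2 = .m s := fun g s => map_m (hc _)
  have hw : ∀ g x, ∃ x', c x' = c x ∧ (φ (g, .w x)).2 = .w x' := fun g x => map_w (hc _)
  choose τ hτ1 hτ2 using hw
  have Da : ∀ g, (g, Y.a) ∉ D := fun g h => by have := hD _ _ h; simp at this
  have Db : ∀ g, (g, Y.b) ∉ D := fun g h => by have := hD _ _ h; simp at this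
  have Dm : ∀ g s, (g, Y.m s) ∉ D := fun g s h => by have := hD _ _ h; simp at this
  have hadj := CAut.adj hφ
  have e : ∀ p : Γ × Y Γ W, p = (p.1, p.2) := fun p => rfl
  have key : ∀ g y, (g, y) ∉ D → (φ (g, y)).1 = (φ (g, .a)).1 := by
    intro g y hy
    by_cases hya : y = .a
    · rw [hya]
    have h1 := (hadj (g, .a) (g, y) (Da g) hy).2 ((adj_a _ _ _ hya).2 rfl)
    rw [e (φ (g, .a)), e (φ (g, y)), ha] at h1
    have h2 := hc (g, y)
    revert h1
    cases hz : (φ (g, y)).2 <;> simp [SG, adj, eq_comm]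
  have key2 : ∀ g s, (φ (g * s, .a)).1 = (φ (g, .a)).1 * s := by
    intro g s
    have h1 := (hadj (g, .m s) (g * s, .b) (Dm _ _) (Db _)).2 (by simp [SG, adj])
    rw [e (φ (g, .m s)), e (φ (g * s, .b)), hm, hb, key _ _ (Dm _ _), key _ _ (Db _)] at h1
    simpa [SG, adj, eq_comm] using h1
  have key3 : ∀ g y, (g, y) ∉ D → (φ (g, y)).1 = (φ (1, .a)).1 * g := by
    intro g y hy
    rw [key g y hy, ← key2, one_mul]
  refine ⟨(φ (1, .a)).1, τ, ?_, ?_, ?_, hu, ?_, hτ2, ?_, hτ1⟩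
  · intro g; rw [← key3 g .a (Da _)]; exact Prod.ext rfl (ha g)
  · intro g; rw [← key3 g .b (Db _)]; exact Prod.ext rfl (hb g)
  · intro g s; rw [← key3 g _ (Dm _ s)]; exact Prod.ext rfl (hm g s)
  · intro g h; rw [← key3 g _ h]; exact Prod.ext rfl (hu g)
  · intro g x h; rw [← key3 g _ h]; exact Prod.ext rfl (hτ2 g x)

/-- copies that are untouched are rigid -/
theorem rigid_copy [Finite W] (hr : ∀ σ ∈ CAut H c ∅, σ r = r → σ = 1)
    (hφ : φ ∈ CAut (SG Γ H r) (col Γ c) D) (h g : Γ) (t : W → W)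
    (hgu : (g, .u) ∉ D) (hgw : ∀ x, (g, .w x) ∉ D)
    (hu : φ (g, .u) = (h, .u)) (hw : ∀ x, φ (g, .w x) = (h, .w (t x)))
    (hc : ∀ x, c (t x) = c x) : ∀ x, t x = x := by
  have hadj := CAut.adj hφ
  obtain ⟨σ, hσ, hσt⟩ := CAut.of_fun (G := H) (c := c) (D := ∅) t
    (fun x y hxy => by
      have : φ (g, .w x) = φ (g, .w y) := by rw [hw, hw, hxy]
      simpa using this) (by simp)
    (fun x y _ _ => by
      have := hadj _ _ (hgw x) (hgw y)
      rw [hw, hw] at this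
      simpa [SG, adj] using this) hc
  have h1 := hr σ hσ (by
    have := hadj _ _ hgu (hgw r)
    rw [hu, hw] at this
    rw [hσt]
    simpa [SG, adj] using this)
  intro x
  rw [← hσt, h1]; rfl

theorem full_eq [Finite W] (hr : ∀ σ ∈ CAut H c ∅, σ r = r → σ = 1)
    (hφ : φ ∈ CAut (SG Γ H r) (col Γ c) ∅) : ∃ h, ∀ g y, φ (g, y) = (h * g, y) := by
  obtain ⟨h, τ, ha, hb, hm, -, hu, -, hw, hc⟩ := base hφ (by simp)
  have ht : ∀ g x, τ g x = x := fun g => rigid_copy hr hφ (h * g) g (τ g) (by simp) (by simp)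
    (hu g (by simp)) (fun x => hw g x (by simp)) (hc g)
  refine ⟨h, ?_⟩
  rintro g (_ | _ | _ | s | x)
  · exact ha g
  · exact hb g
  · exact hu g (by simp)
  · exact hm g s
  · rw [hw g x (by simp), ht]

theorem new_rigid [Finite W] (hr : ∀ σ ∈ CAut H c ∅, σ r = r → σ = 1)
    (hφ : φ ∈ CAut (SG Γ H r) (col Γ c) ∅) (h1 : φ (1, .a) = (1, .a)) : φ = 1 := by
  obtain ⟨h, hh⟩ := full_eq hr hφ
  rw [hh] at h1
  have : h = 1 := by simpa using h1
  subst this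
  ext1 ⟨g, y⟩
  simp [hh]

def lmul (Γ W : Type) [Group Γ] : Γ →* Equiv.Perm (Γ × Y Γ W) where
  toFun h := Equiv.prodCongr (Equiv.mulLeft h) (Equiv.refl _)
  map_one' := by ext1 ⟨g, y⟩; simp
  map_mul' h k := by ext1 ⟨g, y⟩; simp [mul_assoc]

theorem lmul_mem (h : Γ) : lmul Γ W h ∈ CAut (SG Γ H r) (col Γ c) ∅ := by
  refine ⟨by simp, ?_, ?_⟩
  · rintro ⟨g, _ | _ | _ | s | x⟩ ⟨k, _ | _ | _ | t | y⟩ - - <;>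
      simp [adj, SG, lmul, mul_assoc]
  · rintro ⟨g, y⟩; simp [lmul, col]

theorem full_iso [Finite W] (hr : ∀ σ ∈ CAut H c ∅, σ r = r → σ = 1) :
    Nonempty (CAut (SG Γ H r) (col Γ c) ∅ ≃* Γ) := by
  refine ⟨(MulEquiv.ofBijective ((lmul Γ W).codRestrict (CAut (SG Γ H r) (col Γ c) ∅)
    (fun h => lmul_mem h)) ⟨?_, ?_⟩).symm⟩
  · intro h k hk
    have := congrArg (fun z : CAut (SG Γ H r) (col Γ c) ∅ => z.1 (1, .a)) hk
    simpa [lmul] using this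
  · rintro ⟨φ, hφ⟩
    obtain ⟨h, hh⟩ := full_eq hr hφ
    refine ⟨h, ?_⟩
    ext1; ext1 ⟨g, y⟩
    simp [hh, lmul]

def ND (Γ : Type) [Group Γ] (D : Set W) : Set (Γ × Y Γ W) :=
  {p | p.1 = 1 ∧ (p.2 = .u ∨ ∃ x ∈ D, p.2 = .w x)}

open Classical in
noncomputable def extFun (σ : Equiv.Perm W) : Γ × Y Γ W → Γ × Y Γ W
  | (g, .w x) => (g, .w (if g = 1 then σ x else x))
  | p => p

theorem extFun_one (p : Γ × Y Γ W) : extFun 1 p = p := by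
  obtain ⟨g, _ | _ | _ | s | x⟩ := p <;> simp [extFun]

theorem extFun_mul (σ τ : Equiv.Perm W) (p : Γ × Y Γ W) :
    extFun (σ * τ) p = extFun σ (extFun τ p) := by
  obtain ⟨g, _ | _ | _ | s | x⟩ := p <;> simp [extFun]
  split_ifs <;> simp

noncomputable def ext (Γ W : Type) [Group Γ] : Equiv.Perm W →* Equiv.Perm (Γ × Y Γ W) where
  toFun σ := ⟨extFun σ, extFun σ⁻¹, fun p => by rw [← extFun_mul]; simp [extFun_one],
    fun p => by rw [← extFun_mul]; simp [extFun_one]⟩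
  map_one' := by ext1 p; exact extFun_one p
  map_mul' σ τ := by ext1 p; exact extFun_mul σ τ p

theorem ext_apply (σ : Equiv.Perm W) (p : Γ × Y Γ W) : ext Γ W σ p = extFun σ p := rfl

theorem ext_mem {E : Set W} {σ : Equiv.Perm W} (hσ : σ ∈ CAut H c E) :
    ext Γ W σ ∈ CAut (SG Γ H r) (col Γ c) (ND Γ E) := by
  have h1 := CAut.fix hσ
  have h2 := CAut.adj hσ
  have h3 := CAut.col hσ
  refine ⟨?_, ?_, ?_⟩
  · rintro ⟨g, y⟩ ⟨h, h' | ⟨x, hx, h'⟩⟩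
    · simp only at h h'; subst h h'; rfl
    · simp only at h h'; subst h h'
      simp [ext_apply, extFun, h1 x hx]
  · rintro ⟨g, _ | _ | _ | s | x⟩ ⟨k, _ | _ | _ | t | y⟩ hx hy <;>
      simp [adj, SG, ext_apply, extFun] <;> simp [ND] at hx hy
    · rintro rfl; simp [hx]
    · rintro rfl; simp [hy]
    · rintro rfl
      split_ifs with hg
      · exact h2 x y (hx hg) (hy hg)
      · rfl
  · rintro ⟨g, _ | _ | _ | s | x⟩ <;> simp [col, ext_apply, extFun, Y.map]
    split_ifs <;> simp [h3]

theorem ext_surj [Finite W] (hr : ∀ σ ∈ CAut H c ∅, σ r = r → σ = 1) {E : Set W}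
    (hφ : φ ∈ CAut (SG Γ H r) (col Γ c) (ND Γ E)) : ∃ σ ∈ CAut H c E, ext Γ W σ = φ := by
  obtain ⟨h, τ, ha, hb, hm, hu2, hu, hw2, hw, hc⟩ := base hφ (by
    rintro g y ⟨-, h | ⟨x, -, h⟩⟩
    · exact .inl h
    · exact .inr ⟨x, h⟩)
  have hfix := CAut.fix hφ
  have h1u : φ (1, .u) = (1, .u) := hfix _ ⟨rfl, .inl rfl⟩
  have hh : h = 1 := by
    by_contra hne
    obtain ⟨⟨g, y⟩, hp⟩ := φ.surjective (h, .u)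
    have hy : y = .u := by
      have := CAut.col hφ (g, y)
      rw [hp] at this
      exact map_u this.symm
    subst hy
    by_cases hg : g = 1
    · subst hg; rw [h1u] at hp; simp at hp; exact hne hp.symm
    · rw [hu g (by simp [ND, hg])] at hp
      simp at hp; exact hg hp
  subst hh
  simp only [one_mul] at *
  have ht : ∀ g ≠ 1, ∀ x, τ g x = x := fun g hg => rigid_copy hr hφ g g (τ g)
    (by simp [ND, hg]) (by simp [ND, hg]) (hu g (by simp [ND, hg]))
    (fun x => hw g x (by simp [ND, hg])) (hc g)
  have hw1 : ∀ x, φ (1, .w x) = (1, .w (τ 1 x)) := by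
    intro x
    by_cases hx : x ∈ E
    · have := hfix (1, .w x) ⟨rfl, .inr ⟨x, hx, rfl⟩⟩
      rw [← hw2, this]
    · exact hw 1 x (by simp [ND, hx])
  have hfixE : ∀ x ∈ E, τ 1 x = x := fun x hx => by
    have := hfix (1, .w x) ⟨rfl, .inr ⟨x, hx, rfl⟩⟩
    rw [hw1] at this
    simpa using this
  obtain ⟨σ, hσ, hσt⟩ := CAut.of_fun (G := H) (c := c) (D := E) (τ 1)
    (fun x y hxy => by
      have : φ (1, .w x) = φ (1, .w y) := by rw [hw1, hw1, hxy]
      simpa using this) hfixE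
    (fun x y hx hy => by
      have := CAut.adj hφ (1, .w x) (1, .w y) (by simp [ND, hx]) (by simp [ND, hy])
      rw [hw1, hw1] at this
      simpa [SG, adj] using this) (hc 1)
  refine ⟨σ, hσ, ?_⟩
  ext1 ⟨g, y⟩
  rw [ext_apply]
  rcases y with _ | _ | _ | s | x
  · exact (ha g).symm
  · exact (hb g).symm
  · by_cases hg : g = 1
    · subst hg; exact h1u.symm
    · exact (hu g (by simp [ND, hg])).symm
  · exact (hm g s).symm
  · by_cases hg : g = 1
    · subst hg; rw [hw1]; simp [extFun, hσt]
    · rw [hw g x (by simp [ND, hg]), ht g hg]; simp [extFun, hg]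

theorem ext_inj (σ τ : Equiv.Perm W) (h : ext Γ W σ = ext Γ W τ) : σ = τ := by
  ext1 x
  have := congrArg (fun z => z (1, Y.w x)) h
  simpa [ext_apply, extFun] using this

theorem step_iso [Finite W] (hr : ∀ σ ∈ CAut H c ∅, σ r = r → σ = 1) (E : Set W) :
    Nonempty (CAut (SG Γ H r) (col Γ c) (ND Γ E) ≃* CAut H c E) := by
  refine ⟨(MulEquiv.ofBijective (((ext Γ W).comp (CAut H c E).subtype).codRestrict
    (CAut (SG Γ H r) (col Γ c) (ND Γ E)) (fun σ => ext_mem σ.2)) ⟨?_, ?_⟩).symm⟩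
  · intro σ τ h
    exact Subtype.ext (ext_inj (Γ := Γ) _ _ (congrArg Subtype.val h))
  · rintro ⟨φ, hφ⟩
    obtain ⟨σ, hσ, rfl⟩ := ext_surj hr hφ
    exact ⟨⟨σ, hσ⟩, rfl⟩
end

theorem colored (k : ℕ) : ∀ (Γ : ℕ → Type) [∀ i, Group (Γ i)] [∀ i, Finite (Γ i)],
    ∃ (W : Type) (_ : Finite W) (C : Type) (H : SimpleGraph W) (c : W → C) (v : ℕ → W) (r : W),
      (∀ i < k, ∀ j < k, v i = v j → i = j) ∧ (∀ σ ∈ CAut H c ∅, σ r = r → σ = 1) ∧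
      ∀ i < k, Nonempty (CAut H c (v '' Set.Iio i) ≃* Γ i) := by
  induction k with
  | zero =>
    intro Γ _ _
    exact ⟨Unit, inferInstance, Unit, ⊥, id, fun _ => (), (), by simp,
      fun σ _ _ => Subsingleton.elim _ _, by simp⟩
  | succ k ih =>
    intro Γ _ _
    obtain ⟨W, _, C, H, c, v, r, hv, hr, hi⟩ := ih (fun n => Γ (n + 1))
    refine ⟨Γ 0 × Y (Γ 0) W, inferInstance, Y (Γ 0) C, SG (Γ 0) H r, col (Γ 0) c,
      fun n => (1, match n with | 0 => .u | n + 1 => .w (v n)), (1, .a), ?_, ?_, ?_⟩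
    · rintro (_ | i) hi (_ | j) hj h <;> simp at h
      · rfl
      · rw [hv i (by omega) j (by omega) h]
    · intro σ hσ h
      exact new_rigid hr hσ h
    · rintro (_ | i) hlt
      · have := full_iso (Γ := Γ 0) hr
        rwa [show Set.Iio 0 = (∅ : Set ℕ) by ext; simp, Set.image_empty]
      · obtain ⟨e⟩ := hi i (by omega)
        obtain ⟨e'⟩ := step_iso (Γ := Γ 0) hr (v '' Set.Iio i)
        rw [show _ '' Set.Iio (i + 1) = ND (Γ 0) (v '' Set.Iio i) from ?_]
        · exact ⟨e'.trans e⟩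
        ext ⟨g, y⟩
        simp only [ND, Set.mem_image, Set.mem_Iio, Set.mem_ofPred_eq, Prod.mk.injEq]
        constructor
        · rintro ⟨_ | n, hn, rfl, rfl⟩
          · exact ⟨rfl, .inl rfl⟩
          · exact ⟨rfl, .inr ⟨v n, ⟨n, by omega, rfl⟩, rfl⟩⟩
        · rintro ⟨rfl, rfl | ⟨x, ⟨n, hn, rfl⟩, rfl⟩⟩
          · exact ⟨0, by omega, rfl, rfl⟩
          · exact ⟨n + 1, by omega, rfl, rfl⟩

section
variable {V : Type} {M : ℕ}

def hadj (G : SimpleGraph V) (c : V → ℕ) : V ⊕ Fin M → V ⊕ Fin M → Prop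
  | .inl x, .inl y => G.Adj x y
  | .inl x, .inr i => (i : ℕ) = 0 ∨ (i : ℕ) = c x + 1
  | .inr i, .inl x => (i : ℕ) = 0 ∨ (i : ℕ) = c x + 1
  | .inr i, .inr j => i ≠ j ∧ (i : ℕ) ≠ j + 1 ∧ (j : ℕ) ≠ i + 1

def HG (M : ℕ) (G : SimpleGraph V) (c : V → ℕ) : SimpleGraph (V ⊕ Fin M) where
  Adj := hadj G c
  symm := ⟨by
    rintro (x | i) (y | j) h
    · exact G.adj_symm h
    · exact h
    · exact h
    · exact ⟨h.1.symm, h.2.2, h.2.1⟩⟩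
  loopless := ⟨by
    rintro (x | i) h
    · exact G.loopless.irrefl x h
    · exact h.1 rfl⟩

variable {G : SimpleGraph V} {c : V → ℕ} {D : Set V}

abbrev UA (G : SimpleGraph V) (D : Set V) : Subgroup (Equiv.Perm V) := CAut G (fun _ => ()) D

theorem not_cross [Finite V] {σ : Equiv.Perm (V ⊕ Fin M)} (hM : Nat.card V + 10 ≤ M)
    (hσ : σ ∈ UA (HG M G c) (Sum.inl '' D)) (x : V) (i : Fin M) : σ (.inl x) ≠ .inr i := by
  intro h
  have hx : x ∉ D := fun hx => by
    rw [CAut.fix hσ _ ⟨x, hx, rfl⟩] at h; simp at h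
  have hi : ∀ j : Fin M, Sum.inr j ∉ (Sum.inl '' D : Set (V ⊕ Fin M)) := by simp
  have hx' : Sum.inl x ∉ (Sum.inl '' D : Set (V ⊕ Fin M)) := by simpa using hx
  -- the neighbours of `inr i` inside the gadget
  have hM0 : 0 < M := by omega
  let T : Finset (Fin M) := {j | i ≠ j ∧ (i : ℕ) ≠ j + 1 ∧ (j : ℕ) ≠ i + 1}
  have hT : M ≤ T.card + 3 := by
    have h1 : Tᶜ.card ≤ 3 := by
      have : Tᶜ.image (fun j : Fin M => (j : ℕ)) ⊆ {(i : ℕ) - 1, (i : ℕ), (i : ℕ) + 1} := by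
        intro n hn
        simp only [Finset.mem_image, Finset.mem_compl, T, Finset.mem_filter, Finset.mem_univ,
          true_and] at hn
        obtain ⟨j, hj, rfl⟩ := hn
        simp only [Finset.mem_insert, Finset.mem_singleton]
        have : i = j → (i : ℕ) = j := fun h => by rw [h]
        by_contra hcon
        apply hj
        refine ⟨fun h => ?_, ?_, ?_⟩
        · have := this h; omega
        · omega
        · omega
      have h2 := Finset.card_le_card this
      rw [Finset.card_image_of_injective _ Fin.val_injective] at h2
      exact h2.trans Finset.card_le_three
    have := Finset.card_add_card_compl T
    rw [Fintype.card_fin] at this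
    omega
  have : Fintype V := Fintype.ofFinite V
  classical
  let S : Finset (V ⊕ Fin M) := Finset.univ.image Sum.inl ∪
    (Finset.univ.filter (fun j : Fin M => (j : ℕ) = 0 ∨ (j : ℕ) = c x + 1)).image Sum.inr
  have hS : S.card ≤ Nat.card V + 2 := by
    refine (Finset.card_union_le _ _).trans ?_
    rw [Nat.card_eq_fintype_card]
    refine add_le_add Finset.card_image_le (Finset.card_image_le.trans ?_)
    rw [← Finset.card_image_of_injective _ Fin.val_injective]
    refine (Finset.card_le_card (t := {0, c x + 1}) ?_).trans Finset.card_le_two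
    intro n
    simp only [Finset.mem_image, Finset.mem_filter, Finset.mem_univ, true_and, Finset.mem_insert,
      Finset.mem_singleton]
    rintro ⟨j, hj, rfl⟩
    exact hj
  have hsub : T.image (fun j => σ⁻¹ (Sum.inr j)) ⊆ S := by
    intro p hp
    simp only [Finset.mem_image] at hp
    obtain ⟨j, hj, rfl⟩ := hp
    have hσ' := inv_mem hσ
    have h1 := (CAut.adj hσ' _ _ (hi i) (hi j)).2 (by
      change _ ∧ _ ∧ _
      simpa [T] using hj)
    rw [← h, show σ⁻¹ (σ (Sum.inl x)) = Sum.inl x from σ.symm_apply_apply _] at h1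
    generalize σ⁻¹ (Sum.inr j) = q at h1 ⊢
    rcases q with y | k
    · simp [S]
    · simp only [S, Finset.mem_union, Finset.mem_image, Finset.mem_filter, Finset.mem_univ,
        true_and]
      exact .inr ⟨k, h1, rfl⟩
  have h3 := Finset.card_le_card hsub
  rw [Finset.card_image_of_injective _ (fun a b hab => by simpa using hab)] at h3
  omega

theorem hg_surj [Finite V] {σ : Equiv.Perm (V ⊕ Fin M)} (hM : Nat.card V + 10 ≤ M)
    (hcM : ∀ x, c x + 10 ≤ M) (hne : ∃ x, x ∉ D)
    (hσ : σ ∈ UA (HG M G c) (Sum.inl '' D)) :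
    ∃ τ ∈ CAut G c D, Equiv.sumCongr τ 1 = σ := by
  have hq : ∀ x, ∃ y, σ (.inl x) = .inl y := by
    intro x
    rcases h : σ (.inl x) with y | i
    · exact ⟨y, rfl⟩
    · exact absurd h (not_cross hM hσ x i)
  have hp : ∀ i, ∃ j, σ (.inr i) = .inr j := by
    intro i
    rcases h : σ (.inr i) with y | j
    · have : σ⁻¹ (.inl y) = .inr i := by rw [← h]; exact σ.symm_apply_apply _
      exact absurd this (not_cross hM (inv_mem hσ) y i)
    · exact ⟨j, rfl⟩
  choose q hq using hq
  choose p hp using hp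
  have pinj : Function.Injective p := fun i j h => by
    have : σ (.inr i) = σ (.inr j) := by rw [hp, hp, h]
    simpa using this
  have psurj : Function.Surjective p := Finite.surjective_of_injective pinj
  have hi : ∀ j : Fin M, Sum.inr j ∉ (Sum.inl '' D : Set (V ⊕ Fin M)) := by simp
  have hx' : ∀ x, x ∉ D → Sum.inl x ∉ (Sum.inl '' D : Set (V ⊕ Fin M)) := by simp
  have padj : ∀ i j, ((p i ≠ p j ∧ (p i : ℕ) ≠ p j + 1 ∧ (p j : ℕ) ≠ p i + 1) ↔
      (i ≠ j ∧ (i : ℕ) ≠ j + 1 ∧ (j : ℕ) ≠ i + 1)) := by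
    intro i j
    have := CAut.adj hσ _ _ (hi i) (hi j)
    rw [hp, hp] at this
    exact this
  have pc : ∀ i j, ((p i : ℕ) = p j + 1 ∨ (p j : ℕ) = p i + 1) ↔
      ((i : ℕ) = j + 1 ∨ (j : ℕ) = i + 1) := by
    intro i j
    have h1 := padj i j
    by_cases hij : i = j
    · subst hij; simp
    · have : p i ≠ p j := fun h => hij (pinj h)
      tauto
  have qadj : ∀ x i, x ∉ D → (((p i : ℕ) = 0 ∨ (p i : ℕ) = c (q x) + 1) ↔
      ((i : ℕ) = 0 ∨ (i : ℕ) = c x + 1)) := by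
    intro x i hx
    have := CAut.adj hσ _ _ (hx' x hx) (hi i)
    rw [hp, hq] at this
    exact this
  have p0 : ∀ i : Fin M, (i : ℕ) = 0 → (p i : ℕ) = 0 := by
    intro i hi0
    obtain ⟨x, hx⟩ := hne
    by_contra hne0
    have h1 := (qadj x i hx).2 (.inl hi0)
    have h2 : (p i : ℕ) = c (q x) + 1 := by tauto
    have h3 := hcM (q x)
    obtain ⟨j, hj⟩ := psurj ⟨p i - 1, by omega⟩
    obtain ⟨k, hk⟩ := psurj ⟨p i + 1, by omega⟩
    have hj' := congrArg Fin.val hj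
    have hk' := congrArg Fin.val hk
    simp only at hj' hk'
    have h4 := (pc i j).1 (by omega)
    have h5 := (pc i k).1 (by omega)
    have h6 : j = k := Fin.ext (by omega)
    subst h6
    omega
  have pid : ∀ n, ∀ i : Fin M, (i : ℕ) = n → p i = i := by
    intro n
    induction n using Nat.strong_induction_on with
    | _ n ih =>
      intro i hin
      rcases n with _ | n
      · exact Fin.ext (by rw [p0 i hin, hin])
      · let j : Fin M := ⟨n, by omega⟩
        have hj : p j = j := ih n (by omega) j rfl
        have hjv : (j : ℕ) = n := rfl
        have h1 := (pc i j).2 (by omega)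
        rw [hj] at h1
        rcases h1 with h1 | h1
        · exact Fin.ext (by omega)
        · exfalso
          have h2 := ih (p i) (by omega) (p i) rfl
          have h3 := pinj h2
          rw [h3] at h1
          omega
  have qfix : ∀ x ∈ D, q x = x := fun x hx => by
    have := CAut.fix hσ _ ⟨x, hx, rfl⟩
    rw [hq] at this
    simpa using this
  obtain ⟨τ, hτ, hτq⟩ := CAut.of_fun (G := G) (c := c) (D := D) q
    (fun x y h => by
      have : σ (.inl x) = σ (.inl y) := by rw [hq, hq, h]
      simpa using this) qfix
    (fun x y hx hy => by
      have := CAut.adj hσ _ _ (hx' x hx) (hx' y hy)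
      rw [hq, hq] at this
      exact this)
    (fun x => by
      by_cases hx : x ∈ D
      · rw [qfix x hx]
      · have h1 := (qadj x ⟨c x + 1, by have := hcM x; omega⟩ hx).2 (.inr rfl)
        rw [pid _ _ rfl] at h1
        simp at h1
        exact h1.symm)
  refine ⟨τ, hτ, ?_⟩
  ext1 z
  rcases z with x | i
  · simp [hq, hτq]
  · simp [hp, pid _ i rfl]

def emb (V : Type) (M : ℕ) : Equiv.Perm V →* Equiv.Perm (V ⊕ Fin M) where
  toFun τ := Equiv.sumCongr τ 1
  map_one' := by ext1 (x | i) <;> simp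
  map_mul' σ τ := by ext1 (x | i) <;> simp

theorem emb_mem {τ : Equiv.Perm V} (h : τ ∈ CAut G c D) :
    emb V M τ ∈ UA (HG M G c) (Sum.inl '' D) := by
  refine ⟨?_, ?_, by simp⟩
  · rintro _ ⟨x, hx, rfl⟩
    simp [emb, CAut.fix h x hx]
  · rintro (x | i) (y | j) hx hy
    · exact CAut.adj h x y (by simpa using hx) (by simpa using hy)
    · simp [HG, hadj, emb, CAut.col h]
    · simp [HG, hadj, emb, CAut.col h]
    · simp [HG, hadj, emb]

theorem emb_iso [Finite V] (hM : Nat.card V + 10 ≤ M)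
    (hcM : ∀ x, c x + 10 ≤ M) (hne : ∃ x, x ∉ D) :
    Nonempty (UA (HG M G c) (Sum.inl '' D) ≃* CAut G c D) := by
  refine ⟨(MulEquiv.ofBijective (((emb V M).comp (CAut G c D).subtype).codRestrict
    (UA (HG M G c) (Sum.inl '' D)) (fun σ => emb_mem σ.2)) ⟨?_, ?_⟩).symm⟩
  · intro σ τ h
    have h' := congrArg Subtype.val h
    ext1; ext1 x
    have := congrArg (fun z => z (Sum.inl x)) h'
    simpa [emb] using this
  · rintro ⟨φ, hφ⟩
    obtain ⟨σ, hσ, rfl⟩ := hg_surj hM hcM hne hφ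
    exact ⟨⟨σ, hσ⟩, rfl⟩

theorem aut_iso (G : SimpleGraph V) : Nonempty ((G ≃g G) ≃* UA G ∅) :=
  ⟨{ toFun := fun f => ⟨f.toEquiv, by simp, fun x y _ _ => f.map_rel_iff, by simp⟩
     invFun := fun σ => ⟨σ.1, fun {x y} => CAut.adj σ.2 x y (by simp) (by simp)⟩
     left_inv := fun f => rfl
     right_inv := fun f => rfl
     map_mul' := fun f g => rfl }⟩

theorem ind_iso (G : SimpleGraph V) (D : Set V) :
    Nonempty ((G.induce (Dᶜ : Set V) ≃g G.induce (Dᶜ : Set V)) ≃* UA G D) := by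
  classical
  let F : (G.induce (Dᶜ : Set V) ≃g G.induce (Dᶜ : Set V)) →* Equiv.Perm V :=
    { toFun := fun f => Equiv.Perm.ofSubtype f.toEquiv
      map_one' := map_one (Equiv.Perm.ofSubtype (p := fun x => x ∈ (Dᶜ : Set V)))
      map_mul' := fun f g =>
        map_mul (Equiv.Perm.ofSubtype (p := fun x => x ∈ (Dᶜ : Set V))) f.toEquiv g.toEquiv }
  have hF : ∀ f x (hx : x ∉ D), F f x = f ⟨x, hx⟩ := fun f x hx =>
    Equiv.Perm.ofSubtype_apply_of_mem (p := fun x => x ∈ (Dᶜ : Set V)) f.toEquiv hx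
  have hF' : ∀ f x (hx : x ∈ D), F f x = x := fun f x hx =>
    Equiv.Perm.ofSubtype_apply_of_not_mem (p := fun x => x ∈ (Dᶜ : Set V)) f.toEquiv (by simpa)
  have hFm : ∀ f, F f ∈ UA G D := by
    intro f
    refine ⟨hF' f, fun x y hx hy => ?_, by simp⟩
    rw [hF f x hx, hF f y hy]
    exact f.map_rel_iff (a := ⟨x, hx⟩) (b := ⟨y, hy⟩)
  refine ⟨MulEquiv.ofBijective (F.codRestrict (UA G D) hFm) ⟨?_, ?_⟩⟩
  · intro f g h
    have h' : F f = F g := congrArg Subtype.val h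
    ext ⟨x, hx⟩
    rw [← hF, ← hF, h']
  · rintro ⟨σ, hσ⟩
    have hn := CAut.nmem hσ
    have hn' := CAut.nmem (inv_mem hσ)
    refine ⟨⟨⟨fun x => ⟨σ x, hn _ x.2⟩, fun x => ⟨σ⁻¹ x, hn' _ x.2⟩, fun x => by simp,
      fun x => by simp⟩, fun {x y} => CAut.adj hσ x y x.2 y.2⟩, ?_⟩
    ext1; ext1 x
    by_cases hx : x ∈ D
    · exact (hF' _ x hx).trans (CAut.fix hσ x hx).symm
    · exact (hF _ x hx)
end

theorem CAut_congr {V C C' : Type} (G : SimpleGraph V) (c : V → C) (c' : V → C') (D : Set V)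
    (h : ∀ x y, c x = c y ↔ c' x = c' y) : CAut G c D = CAut G c' D := by
  ext σ
  change (_ ∧ _ ∧ _) ↔ (_ ∧ _ ∧ _)
  simp only [h]

end IterDel

theorem iterated_deletions (k : ℕ) (hk : 1 ≤ k) (Γ : Fin (k + 1) → Type)
    [∀ i, Group (Γ i)] [∀ i, Finite (Γ i)] :
    ∃ (V : Type) (_ : Fintype V) (G : SimpleGraph V) (v : Fin k → V),
      Function.Injective v ∧
      Nonempty ((G ≃g G) ≃* Γ 0) ∧
      ∀ i : Fin k,
        Nonempty ((G.induce ((v '' Set.Iic i)ᶜ : Set V) ≃g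
          G.induce ((v '' Set.Iic i)ᶜ : Set V)) ≃* Γ i.succ) := by
  obtain ⟨W, _, C, H, c, v, r, hv, -, hi⟩ :=
    IterDel.colored (k + 1) (fun n => Γ (Fin.ofNat (k + 1) n))
  have : Fintype W := Fintype.ofFinite W
  obtain ⟨e⟩ := Finite.exists_equiv_fin (Set.range c) |>.choose_spec
  let c' : W → ℕ := fun x => (e ⟨c x, Set.mem_range_self x⟩ : ℕ)
  have hcc : ∀ x y, c x = c y ↔ c' x = c' y := by
    intro x y
    simp only [c', Fin.val_inj, EmbeddingLike.apply_eq_iff_eq]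
    exact ⟨fun h => Subtype.ext h, fun h => congrArg Subtype.val h⟩
  obtain ⟨m, hm⟩ := (Set.finite_range c').bddAbove
  have hm' : ∀ x, c' x ≤ m := fun x => hm ⟨x, rfl⟩
  have main : ∀ i, i < k + 1 → Nonempty (IterDel.UA (IterDel.HG (Nat.card W + m + 10) H c')
      (Sum.inl '' (v '' Set.Iio i)) ≃* Γ (Fin.ofNat (k + 1) i)) := by
    intro i hik
    obtain ⟨e1⟩ := hi i hik
    rw [IterDel.CAut_congr H c c' _ hcc] at e1
    obtain ⟨e2⟩ := IterDel.emb_iso (M := Nat.card W + m + 10) (G := H) (c := c')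
      (D := v '' Set.Iio i) (by omega) (fun x => by have := hm' x; omega) ⟨v k, by
        rintro ⟨j, hj, hjk⟩
        have hj' : j < i := hj
        have := hv j (by omega) k (by omega) hjk
        omega⟩
    exact ⟨e2.trans e1⟩
  refine ⟨W ⊕ Fin (Nat.card W + m + 10), inferInstance, IterDel.HG _ H c',
    fun i => .inl (v i), ?_, ?_, ?_⟩
  · intro i j hij
    have h : v i = v j := by simpa using hij
    exact Fin.ext (hv i (by omega) j (by omega) h)
  · obtain ⟨e1⟩ := main 0 (by omega)
    rw [show Set.Iio 0 = (∅ : Set ℕ) by ext; simp, Set.image_empty, Set.image_empty] at e1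
    obtain ⟨e2⟩ := IterDel.aut_iso (IterDel.HG (Nat.card W + m + 10) H c')
    exact ⟨e2.trans e1⟩
  · intro i
    obtain ⟨e1⟩ := main (i + 1) (by omega)
    have hs : (fun i : Fin k => (Sum.inl (v i) : W ⊕ Fin (Nat.card W + m + 10))) '' Set.Iic i
        = Sum.inl '' (v '' Set.Iio (i + 1 : ℕ)) := by
      ext z
      constructor
      · rintro ⟨j, hj, rfl⟩
        have hj' : j ≤ i := hj
        exact ⟨v j, ⟨j, Nat.lt_succ_of_le hj', rfl⟩, rfl⟩
      · rintro ⟨_, ⟨j, hj, rfl⟩, rfl⟩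
        have hj' : j < i + 1 := hj
        exact ⟨⟨j, by omega⟩, Fin.le_def.2 (Nat.le_of_lt_succ hj'), rfl⟩
    rw [hs]
    obtain ⟨e2⟩ := IterDel.ind_iso (IterDel.HG (Nat.card W + m + 10) H c')
      (Sum.inl '' (v '' Set.Iio (i + 1 : ℕ)))
    have hidx : Fin.ofNat (k + 1) (i + 1) = i.succ := by
      ext; simp [Fin.ofNat]
    rw [hidx] at e1
    exact ⟨e2.trans e1⟩
end

section
/- For all integers k, ℓ ≥ 1 and all finite groups Γ₀, Γ₁, …, Γ_k, there exists a finite simple graph G₀ with Aut(G₀) isomorphic to Γ₀, together with a strategy function σ that assigns to every nonempty sequence (i₁, …, i_j) with j ≤ ℓ and each i_m ∈ {1, …, k} a vertex σ(i₁, …, i_j) ∈ V(G₀), such that for every sequence (i₁, …, i_ℓ) ∈ {1, …, k}^ℓ, setting v_j = σ(i₁, …, i_j) for j = 1, …, ℓ, the vertices v₁, …, v_ℓ are pairwise distinct and for every j ∈ {1, …, ℓ} the automorphism group of the subgraph of G₀ induced on V(G₀) \ {v₁, …, v_j} is isomorphic to Γ_{i_j}. -/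
namespace VDG

/-! ### Tails -/

def Tinf {W : Type} (B : SimpleGraph W) : SimpleGraph (W × ℕ) where
  Adj p q := (p.2 = 0 ∧ q.2 = 0 ∧ B.Adj p.1 q.1) ∨
    (p.1 = q.1 ∧ (q.2 = p.2 + 1 ∨ p.2 = q.2 + 1))
  symm := ⟨by
    rintro p q (⟨h1, h2, h3⟩ | ⟨h1, h2⟩)
    · exact Or.inl ⟨h2, h1, h3.symm⟩
    · exact Or.inr ⟨h1.symm, h2.symm⟩⟩
  loopless := ⟨by
    rintro p (⟨h1, h2, h3⟩ | ⟨h1, h2⟩)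
    · exact B.loopless.irrefl _ h3
    · omega⟩

def SK {W : Type} (κ : W → ℕ) : Set (W × ℕ) := {p | p.2 ≤ κ p.1}

abbrev TG {W : Type} (B : SimpleGraph W) (κ : W → ℕ) : SimpleGraph (SK κ) :=
  (Tinf B).induce (SK κ)

section tails
variable {W : Type} {B : SimpleGraph W} {κ : W → ℕ}

def base (κ : W → ℕ) (b : W) : SK κ := ⟨(b, 0), Nat.zero_le _⟩

lemma adj_tail {p q : W × ℕ} (hp : 1 ≤ p.2) (h : (Tinf B).Adj p q) :
    q = (p.1, p.2 + 1) ∨ q = (p.1, p.2 - 1) := by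
  obtain ⟨b, t⟩ := p
  obtain ⟨b', t'⟩ := q
  simp only [Tinf] at h hp ⊢
  rcases h with ⟨h1, h2, h3⟩ | ⟨h1, h2 | h2⟩
  · omega
  · left; simp_all
  · right; simp_all

lemma core_aux (hdeg : ∀ b, ∃ c d, c ≠ d ∧ B.Adj b c ∧ B.Adj b d)
    (ψ : TG B κ ≃g TG B κ) (b' : W) (t : ℕ) (ht : 1 ≤ t)
    (h : ∃ b, (ψ (base κ b)).1 = (b', t)) : ∃ b, (ψ (base κ b)).1 = (b', t + 1) := by
  obtain ⟨b, hb⟩ := h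
  obtain ⟨c, d, hcd, hc, hd⟩ := hdeg b
  have key : ∀ e, B.Adj b e →
      (ψ (base κ e)).1 = (b', t + 1) ∨ (ψ (base κ e)).1 = (b', t - 1) := by
    intro e he
    have h1 : (TG B κ).Adj (base κ b) (base κ e) := Or.inl ⟨rfl, rfl, he⟩
    have h2 : (Tinf B).Adj (ψ (base κ b)).1 (ψ (base κ e)).1 := ψ.map_rel_iff.2 h1
    rw [hb] at h2
    exact adj_tail (p := (b', t)) ht h2
  rcases key c hc with h | h
  · exact ⟨c, h⟩
  rcases key d hd with h' | h'
  · exact ⟨d, h'⟩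
  exfalso
  have := ψ.injective (Subtype.ext (h.trans h'.symm))
  apply hcd
  have := congrArg (fun z => z.1.1) this
  simpa [base] using this

lemma core (hdeg : ∀ b, ∃ c d, c ≠ d ∧ B.Adj b c ∧ B.Adj b d)
    (ψ : TG B κ ≃g TG B κ) (b : W) : (ψ (base κ b)).1.2 = 0 := by
  by_contra hne
  set b' := (ψ (base κ b)).1.1 with hb'
  set t := (ψ (base κ b)).1.2 with ht
  have : ∀ n, ∃ b, (ψ (base κ b)).1 = (b', t + n) := by
    intro n
    induction n with
    | zero => exact ⟨b, rfl⟩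
    | succ n ih => exact core_aux hdeg ψ b' (t + n) (by omega) ih
  obtain ⟨e, he⟩ := this (κ b' + 1)
  have h : (ψ (base κ e)).1.2 ≤ κ (ψ (base κ e)).1.1 := (ψ (base κ e)).2
  rw [he] at h
  simp only at h
  omega

def proj (ψ : TG B κ ≃g TG B κ) (b : W) : W := (ψ (base κ b)).1.1

lemma base_proj (hdeg : ∀ b, ∃ c d, c ≠ d ∧ B.Adj b c ∧ B.Adj b d)
    (ψ : TG B κ ≃g TG B κ) (b : W) : ψ (base κ b) = base κ (proj ψ b) := by
  apply Subtype.ext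
  apply Prod.ext
  · rfl
  · exact core hdeg ψ b

lemma proj_symm (hdeg : ∀ b, ∃ c d, c ≠ d ∧ B.Adj b c ∧ B.Adj b d)
    (ψ : TG B κ ≃g TG B κ) (b : W) : proj ψ.symm (proj ψ b) = b := by
  have h : ψ.symm (base κ (proj ψ b)) = base κ b := by
    rw [← base_proj hdeg]; simp
  simp [proj, base] at h ⊢
  rw [h]

lemma tail_form (hdeg : ∀ b, ∃ c d, c ≠ d ∧ B.Adj b c ∧ B.Adj b d)
    (ψ : TG B κ ≃g TG B κ) (b : W) (t : ℕ) :
    ∀ h : t ≤ κ b, (ψ ⟨(b, t), h⟩).1 = (proj ψ b, t) := by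
  induction t using Nat.strong_induction_on with
  | _ t ih =>
    intro h
    rcases t with _ | t
    · exact congrArg Subtype.val (base_proj hdeg ψ b)
    have h0 := ih t (by omega) (by omega)
    have h1 : (TG B κ).Adj ⟨(b, t), (by show t ≤ κ b; omega)⟩ ⟨(b, t + 1), h⟩ :=
      Or.inr ⟨rfl, Or.inl rfl⟩
    have h2 : (Tinf B).Adj (ψ ⟨(b, t), (by show t ≤ κ b; omega)⟩).1 (ψ ⟨(b, t + 1), h⟩).1 :=
      ψ.map_rel_iff.2 h1
    rw [h0] at h2
    rcases t with _ | t
    · rcases h2 with ⟨_, h3, _⟩ | ⟨h3, h4⟩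
      · exfalso
        set z := ψ ⟨(b, 0 + 1), h⟩ with hz
        have e1 : z = base κ z.1.1 := Subtype.ext (Prod.ext rfl h3)
        have e2 : ψ.symm z = ⟨(b, 0 + 1), h⟩ := by rw [hz]; simp
        rw [e1, base_proj hdeg] at e2
        have := congrArg (fun z => z.1.2) e2
        simp [base] at this
      · apply Prod.ext
        · exact h3.symm
        · simp at h4
          exact h4
    · rcases adj_tail (p := (proj ψ b, t + 1)) (by simp) h2 with h3 | h3
      · exact h3
      · exfalso
        have h4 := ih t (by omega) (by omega)
        have h5 : ψ ⟨(b, t + 1 + 1), h⟩ = ψ ⟨(b, t), (by show t ≤ κ b; omega)⟩ :=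
          Subtype.ext (h3.trans (by rw [h4]; rfl))
        have := congrArg (fun z => z.1.2) (ψ.injective h5)
        simp only at this
        omega

lemma proj_le (hdeg : ∀ b, ∃ c d, c ≠ d ∧ B.Adj b c ∧ B.Adj b d)
    (ψ : TG B κ ≃g TG B κ) (b : W) : κ b ≤ κ (proj ψ b) := by
  have h := (ψ ⟨(b, κ b), (le_refl _ : κ b ≤ κ b)⟩).2
  have h2 := tail_form hdeg ψ b (κ b) le_rfl
  simp only [SK, Set.mem_ofPred_eq] at h
  erw [h2] at h
  exact h

/-- Decomposition of automorphisms of a graph with tails. -/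
lemma tails_decomp (hdeg : ∀ b, ∃ c d, c ≠ d ∧ B.Adj b c ∧ B.Adj b d)
    (ψ : TG B κ ≃g TG B κ) : ∃ φ : W ≃ W, (∀ a b, B.Adj (φ a) (φ b) ↔ B.Adj a b) ∧
      (∀ a, κ (φ a) = κ a) ∧ ∀ z : SK κ, (ψ z).1 = (φ z.1.1, z.1.2) := by
  refine ⟨⟨proj ψ, proj ψ.symm, proj_symm hdeg ψ, fun b => proj_symm hdeg ψ.symm b⟩, ?_, ?_, ?_⟩
  · intro a b
    have h := ψ.map_rel_iff (a := base κ a) (b := base κ b)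
    rw [base_proj hdeg, base_proj hdeg] at h
    simpa [TG, Tinf, base] using h
  · intro a
    apply le_antisymm
    · have := proj_le hdeg ψ.symm (proj ψ a)
      rwa [proj_symm hdeg] at this
    · exact proj_le hdeg ψ a
  · rintro ⟨⟨b, t⟩, h⟩
    exact tail_form hdeg ψ b t h

/-- Extension of automorphisms to tails. -/
def tailExt (φ : W ≃ W) (h1 : ∀ a b, B.Adj (φ a) (φ b) ↔ B.Adj a b)
    (h2 : ∀ a, κ (φ a) = κ a) : TG B κ ≃g TG B κ where
  toFun z := ⟨(φ z.1.1, z.1.2), by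
    have := z.2
    simp only [SK, Set.mem_ofPred_eq] at this ⊢
    rwa [h2]⟩
  invFun z := ⟨(φ.symm z.1.1, z.1.2), by
    have := z.2
    simp only [SK, Set.mem_ofPred_eq] at this ⊢
    rwa [← h2, Equiv.apply_symm_apply]⟩
  left_inv z := by simp
  right_inv z := by simp
  map_rel_iff' := by
    intro a b
    simp [TG, Tinf, h1]

end tails

/-! ### Coloured structures -/

inductive WW (X : Type) : Type
  | pt (x : X) : WW X
  | e1 (x y : X) : WW X
  | e2 (x y : X) : WW X

def adjW {X : Type} : WW X → WW X → Prop
  | .pt x, .e1 y _ => x = y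
  | .e1 y _, .pt x => x = y
  | .e1 a b, .e2 c d => a = c ∧ b = d
  | .e2 c d, .e1 a b => a = c ∧ b = d
  | .e2 _ b, .pt x => b = x
  | .pt x, .e2 _ b => b = x
  | _, _ => False

def BW (X : Type) : SimpleGraph (WW X) where
  Adj := adjW
  symm := ⟨by rintro (_ | _ | _) (_ | _ | _) h <;> simp_all [adjW]⟩
  loopless := ⟨by rintro (_ | _ | _) h <;> simp_all [adjW]⟩

lemma BW_deg (X : Type) (b : WW X) : ∃ c d, c ≠ d ∧ (BW X).Adj b c ∧ (BW X).Adj b d := by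
  rcases b with x | ⟨x, y⟩ | ⟨x, y⟩
  · exact ⟨.e1 x x, .e2 x x, by simp, by simp [BW, adjW], by simp [BW, adjW]⟩
  · exact ⟨.pt x, .e2 x y, by simp, by simp [BW, adjW], by simp [BW, adjW]⟩
  · exact ⟨.pt y, .e1 x y, by simp, by simp [BW, adjW], by simp [BW, adjW]⟩

open Classical in
noncomputable def kap {X : Type} (c : X → X → ℕ) (M : Set X) : WW X → ℕ
  | .pt x => if x ∈ M then 1 else 0
  | .e2 _ _ => 2
  | .e1 x y => 3 + c x y

def mapW {X : Type} (π : X → X) : WW X → WW X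
  | .pt x => .pt (π x)
  | .e1 x y => .e1 (π x) (π y)
  | .e2 x y => .e2 (π x) (π y)

def equivW {X : Type} (π : X ≃ X) : WW X ≃ WW X where
  toFun := mapW π
  invFun := mapW π.symm
  left_inv := by rintro (_ | _ | _) <;> simp [mapW]
  right_inv := by rintro (_ | _ | _) <;> simp [mapW]

def Pres {X : Type} (c : X → X → ℕ) (M : Set X) (π : X ≃ X) : Prop :=
  (∀ x y, c (π x) (π y) = c x y) ∧ ∀ x, π x ∈ M ↔ x ∈ M

section col
variable {X : Type} {c : X → X → ℕ} {M : Set X}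

lemma kap_pt_le (x : X) : kap c M (.pt x) ≤ 1 := by
  simp only [kap]; split <;> omega

lemma kap_cases (w : WW X) (x : X) (h : kap c M w = kap c M (.pt x)) : ∃ y, w = .pt y := by
  have := kap_pt_le (c := c) (M := M) x
  rcases w with y | ⟨y, z⟩ | ⟨y, z⟩
  · exact ⟨y, rfl⟩
  · simp only [h.symm] at this; simp [kap] at this; omega
  · simp only [h.symm] at this; simp [kap] at this

lemma kap_cases1 (w : WW X) (x y : X) (h : kap c M w = kap c M (.e1 x y)) :
    ∃ a b, w = .e1 a b := by
  rcases w with a | ⟨a, b⟩ | ⟨a, b⟩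
  · have := kap_pt_le (c := c) (M := M) a
    rw [h] at this; simp [kap] at this; omega
  · exact ⟨a, b, rfl⟩
  · simp [kap] at h; omega

lemma kap_cases2 (w : WW X) (x y : X) (h : kap c M w = kap c M (.e2 x y)) :
    ∃ a b, w = .e2 a b := by
  rcases w with a | ⟨a, b⟩ | ⟨a, b⟩
  · have := kap_pt_le (c := c) (M := M) a
    rw [h] at this; simp [kap] at this
  · simp [kap] at h; omega
  · exact ⟨a, b, rfl⟩

lemma col_decomp (φ : WW X ≃ WW X) (h1 : ∀ a b, (BW X).Adj (φ a) (φ b) ↔ (BW X).Adj a b)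
    (h2 : ∀ a, kap c M (φ a) = kap c M a) :
    ∃ π : X ≃ X, Pres c M π ∧ ∀ w, φ w = mapW π w := by
  have h2' : ∀ a, kap c M (φ.symm a) = kap c M a := fun a => by
    rw [← h2 (φ.symm a)]; simp
  choose f hf using fun x => kap_cases _ x (h2 (.pt x))
  choose g hg using fun x => kap_cases _ x (h2' (.pt x))
  let π : X ≃ X := ⟨f, g, fun x => by
      have : φ.symm (φ (.pt x)) = .pt x := by simp
      rw [hf, hg] at this; simpa using this, fun x => by
      have : φ (φ.symm (.pt x)) = .pt x := by simp
      rw [hg, hf] at this; simpa using this⟩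
  have hπ : ∀ x, φ (.pt x) = .pt (π x) := hf
  have he : ∀ x y, φ (.e1 x y) = .e1 (π x) (π y) ∧ φ (.e2 x y) = .e2 (π x) (π y) := by
    intro x y
    obtain ⟨a, b, hab⟩ := kap_cases1 _ x y (h2 (.e1 x y))
    obtain ⟨a', b', hab'⟩ := kap_cases2 _ x y (h2 (.e2 x y))
    have k1 := (h1 (.pt x) (.e1 x y)).2 (by simp [BW, adjW])
    have k2 := (h1 (.pt y) (.e2 x y)).2 (by simp [BW, adjW])
    have k3 := (h1 (.e1 x y) (.e2 x y)).2 (by simp [BW, adjW])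
    rw [hπ, hab] at k1
    rw [hπ, hab'] at k2
    rw [hab, hab'] at k3
    simp only [BW, adjW] at k1 k2 k3
    obtain ⟨k3, k4⟩ := k3
    rw [hab, hab']
    subst k3 k4
    simp [k1, k2]
  refine ⟨π, ⟨?_, ?_⟩, ?_⟩
  · intro x y
    have := h2 (.e1 x y)
    rw [(he x y).1] at this
    simpa [kap] using this
  · intro x
    have := h2 (.pt x)
    rw [hπ] at this
    simp only [kap] at this
    split_ifs at this <;> simp_all
  · rintro (x | ⟨x, y⟩ | ⟨x, y⟩)
    · exact hπ x
    · exact (he x y).1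
    · exact (he x y).2

noncomputable def colExt (π : X ≃ X) (h : Pres c M π) : TG (BW X) (kap c M) ≃g TG (BW X) (kap c M) :=
  tailExt (equivW π) (by
    rintro (_ | _ | _) (_ | _ | _) <;> simp [BW, adjW, equivW, mapW]) (by
    rintro (x | _ | _)
    · have := h.2 x
      show kap c M (.pt (π x)) = kap c M (.pt x)
      simp only [kap]
      by_cases hx : x ∈ M
      · rw [if_pos hx, if_pos (this.2 hx)]
      · rw [if_neg hx, if_neg (mt this.1 hx)]
    · simp [equivW, mapW, kap, h.1]
    · simp [equivW, mapW, kap])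

/-- Main encoding lemma. -/
lemma encode {K : Type} [Group K] (θ : K →* Equiv.Perm X) (hinj : Function.Injective θ)
    (him : ∀ π, Pres c M π ↔ ∃ k, θ k = π) :
    Nonempty ((TG (BW X) (kap c M) ≃g TG (BW X) (kap c M)) ≃* K) := by
  let F : K →* (TG (BW X) (kap c M) ≃g TG (BW X) (kap c M)) := MonoidHom.mk'
    (fun k => colExt (θ k) ((him _).2 ⟨k, rfl⟩)) (by
      intro a b
      ext ⟨⟨w, t⟩, h⟩ <;> rcases w with _ | _ | _ <;>
        simp [colExt, tailExt, equivW, mapW])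
  refine ⟨(MulEquiv.ofBijective F ⟨?_, ?_⟩).symm⟩
  · intro a b hab
    apply hinj
    ext x
    have := congrArg (fun ψ => (ψ (base _ (.pt x))).1.1) hab
    simpa [F, colExt, tailExt, equivW, mapW, base] using this
  · intro ψ
    obtain ⟨φ, h1, h2, h3⟩ := tails_decomp (BW_deg X) ψ
    obtain ⟨π, h4, h5⟩ := col_decomp φ h1 h2
    obtain ⟨k, rfl⟩ := (him _).1 h4
    refine ⟨k, ?_⟩
    ext z : 1
    apply Subtype.ext
    rw [h3, h5]
    rfl
end col


/-! ### The tree -/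

section tree
variable {ι : Type} {Γ : ι → Type} [∀ i, Group (Γ i)]

open Classical in
noncomputable def act (p : List (Σ i, Γ i)) (i : ι) (a : Γ i) :
    List (Σ i, Γ i) → List (Σ i, Γ i)
  | [] => []
  | q :: x => ⟨q.1, (if x = p then Pi.mulSingle i a q.1 else 1) * q.2⟩ :: act p i a x

variable (p : List (Σ i, Γ i)) (i : ι)

@[simp] lemma act_length (a : Γ i) (x) : (act p i a x).length = x.length := by
  induction x with
  | nil => rfl
  | cons q x ih => simp [act, ih]

lemma act_fix (a : Γ i) (x) (h : x.length ≤ p.length) : act p i a x = x := by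
  induction x with
  | nil => rfl
  | cons q x ih =>
    simp at h
    have : x ≠ p := by rintro rfl; omega
    simp [act, this, ih (by omega)]

lemma act_eq_iff (a : Γ i) (x) : act p i a x = p ↔ x = p := by
  constructor
  · intro h
    have h1 := act_length p i a x
    rw [h] at h1
    rw [act_fix p i a x h1.ge] at h
    exact h
  · rintro rfl
    exact act_fix _ _ _ _ le_rfl

lemma act_mul (a b : Γ i) (x) : act p i (a * b) x = act p i a (act p i b x) := by
  induction x with
  | nil => rfl
  | cons q x ih =>
    have e := act_eq_iff p i b x
    by_cases hx : x = p
    · simp [act, hx, Pi.mulSingle_mul, mul_assoc, act_fix]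
    · have hx' := mt e.1 hx
      simp [act, ih, hx, hx']

lemma act_one (x) : act p i 1 x = x := by
  induction x with
  | nil => rfl
  | cons q x ih => simp [act, ih]

abbrev Node (Γ : ι → Type) (N : ℕ) : Type := {x : List (Σ i, Γ i) // x.length ≤ N}

noncomputable def theta (N : ℕ) : Γ i →* Equiv.Perm (Node Γ N) where
  toFun a := 
    { toFun := fun x => ⟨act p i a x.1, by simpa using x.2⟩
      invFun := fun x => ⟨act p i a⁻¹ x.1, by simpa using x.2⟩
      left_inv := fun x => by simp [← act_mul, act_one]
      right_inv := fun x => by simp [← act_mul, act_one] }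
  map_one' := by ext x : 2; simp [act_one]
  map_mul' a b := by ext x : 2; simp [act_mul]

@[simp] lemma theta_val (N : ℕ) (a : Γ i) (x : Node Γ N) :
    (theta p i N a x).1 = act p i a x.1 := rfl

def Child (x y : List (Σ i, Γ i)) : Prop := ∃ q, y = q :: x

def Sib (r : Σ i, Γ i) (x y : List (Σ i, Γ i)) : Prop :=
  ∃ L g, x = ⟨r.1, g⟩ :: L ∧ y = ⟨r.1, g * r.2⟩ :: L

def colr (x y : List (Σ i, Γ i)) : Prop × ((Σ i, Γ i) → Prop) := (Child x y, fun r => Sib r x y)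

def Marked (p x : List (Σ i, Γ i)) : Prop := (∃ i L, x = ⟨i, 1⟩ :: L) ∧ ¬ x <:+ p

lemma act_child (a : Γ i) {x y} (h : Child x y) : Child (act p i a x) (act p i a y) := by
  obtain ⟨q, rfl⟩ := h
  exact ⟨_, rfl⟩

lemma act_sib (a : Γ i) {r x y} (h : Sib r x y) : Sib r (act p i a x) (act p i a y) := by
  obtain ⟨L, g, rfl, rfl⟩ := h
  exact ⟨_, _, rfl, by simp [act, mul_assoc]⟩

lemma act_colr (a : Γ i) (x y) : colr (act p i a x) (act p i a y) = colr x y := by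
  have e : ∀ z, act p i a⁻¹ (act p i a z) = z := fun z => by simp [← act_mul, act_one]
  unfold colr
  ext1
  · simp only [eq_iff_iff]
    refine ⟨fun h => ?_, act_child p i a⟩
    have := act_child p i a⁻¹ h
    rwa [e, e] at this
  · funext r
    simp only [eq_iff_iff]
    refine ⟨fun h => ?_, act_sib p i a⟩
    have := act_sib p i a⁻¹ h
    rwa [e, e] at this

lemma act_marked (a : Γ i) {x} (h : Marked (⟨i, 1⟩ :: p) x) :
    Marked (⟨i, 1⟩ :: p) (act p i a x) := by
  obtain ⟨⟨i', L, rfl⟩, h2⟩ := h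
  by_cases hL : L = p
  · subst hL
    have : i' ≠ i := by rintro rfl; exact h2 (List.suffix_refl _)
    have e : act L i a (⟨i', 1⟩ :: L) = ⟨i', 1⟩ :: L := by
      classical
      simp [act, Pi.mulSingle_eq_of_ne this, act_fix]
    rw [e]
    exact ⟨⟨_, _, rfl⟩, h2⟩
  · have e : act p i a (⟨i', 1⟩ :: L) = ⟨i', 1⟩ :: act p i a L := by simp [act, hL]
    rw [e]
    refine ⟨⟨_, _, rfl⟩, fun h => h2 ?_⟩
    have hl := h.length_le
    simp at hl
    rwa [act_fix p i a L hl] at h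

lemma theta_inj (N : ℕ) (hp : p.length < N) : Function.Injective (theta p i N) := by
  intro a b h
  have := congrArg (fun π => (π ⟨⟨i, 1⟩ :: p, hp⟩).1) h
  simpa [act, act_fix] using this

variable {p i}

/-- The path condition: every entry is an identity. -/
def OnePath (p : List (Σ i, Γ i)) : Prop := ∀ q ∈ p, q.2 = 1

lemma pres_surj {N : ℕ} (hp : p.length < N) (h1 : OnePath p)
    (π : Node Γ N ≃ Node Γ N)
    (hc : ∀ x y, colr (π x).1 (π y).1 = colr x.1 y.1)
    (hM : ∀ x, Marked (⟨i, 1⟩ :: p) (π x).1 ↔ Marked (⟨i, 1⟩ :: p) x.1) :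
    ∃ a, theta p i N a = π := by
  classical
  have hchild : ∀ x y, Child (π x).1 (π y).1 ↔ Child x.1 y.1 := fun x y => by
    have := congrArg Prod.fst (hc x y)
    simpa [colr] using this
  have hsib : ∀ r x y, Sib r (π x).1 (π y).1 ↔ Sib r x.1 y.1 := fun r x y => by
    have := congrFun (congrArg Prod.snd (hc x y)) r
    simpa [colr] using this
  -- root
  have hroot : (π ⟨[], Nat.zero_le _⟩).1 = [] := by
    rcases h : (π ⟨[], Nat.zero_le _⟩).1 with _ | ⟨q, L⟩
    · rfl
    · exfalso
      have hl : L.length ≤ N := by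
        have := (π ⟨[], Nat.zero_le _⟩).2
        rw [h] at this; simp at this; omega
      have := (hchild (π.symm ⟨L, hl⟩) ⟨[], Nat.zero_le _⟩).1 (by simpa [h] using ⟨q, rfl⟩)
      obtain ⟨q', h'⟩ := this
      simp at h'
  -- local form
  have hloc : ∀ (L : List (Σ i, Γ i)) (hL : L.length ≤ N) (hL' : L.length < N) (i' : ι),
      ∃ b : Γ i', ∀ g : Γ i', (π ⟨⟨i', g⟩ :: L, hL'⟩).1 = ⟨i', b * g⟩ :: (π ⟨L, hL⟩).1 := by
    intro L hL hL' i'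
    have hs : ∀ g : Γ i', Sib ⟨i', g⟩ (π ⟨⟨i', 1⟩ :: L, hL'⟩).1 (π ⟨⟨i', g⟩ :: L, hL'⟩).1 :=
      fun g => (hsib _ _ _).2 ⟨L, 1, rfl, by simp⟩
    obtain ⟨q, hq⟩ := (hchild ⟨L, hL⟩ ⟨⟨i', 1⟩ :: L, hL'⟩).2 ⟨_, rfl⟩
    obtain ⟨L1, b, hb1, -⟩ := hs 1
    rw [hq] at hb1
    simp only [List.cons.injEq] at hb1
    obtain ⟨rfl, rfl⟩ := hb1
    refine ⟨b, fun g => ?_⟩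
    obtain ⟨L2, b2, h3, h4⟩ := hs g
    rw [hq] at h3
    simp only [List.cons.injEq, Sigma.mk.injEq, heq_eq_eq, true_and] at h3
    obtain ⟨rfl, rfl⟩ := h3
    exact h4
  have hlen : ∀ (L : List (Σ i, Γ i)) (hL : L.length ≤ N), (π ⟨L, hL⟩).1.length = L.length := by
    intro L
    induction L with
    | nil => intro _; rw [hroot]
    | cons q L ih =>
      intro hL
      simp at hL
      obtain ⟨b, hb⟩ := hloc L (by omega) hL q.1
      have := hb q.2
      erw [this]
      simp [ih]
  -- suffixes of p are fixed
  have hfix : ∀ (L : List (Σ i, Γ i)) (hL : L.length ≤ N), L <:+ p → (π ⟨L, hL⟩).1 = L := by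
    intro L hL hs
    -- the next node
    obtain ⟨j, hj⟩ : ∃ j : ι, (⟨j, 1⟩ :: L) <:+ (⟨i, 1⟩ :: p) := by
      obtain ⟨t, ht⟩ := hs
      rcases List.eq_nil_or_concat t with rfl | ⟨t', q, rfl⟩
      · simp at ht
        exact ⟨i, by rw [ht]⟩
      · have hq : q.2 = 1 := h1 q (by rw [← ht]; simp)
        refine ⟨q.1, ⟨i, 1⟩ :: t', ?_⟩
        rw [← ht, ← hq]
        simp
    have hLp := hs.length_le
    have hL' : L.length < N := by omega
    obtain ⟨b, hb⟩ := hloc L hL hL' j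
    have hun : ¬ Marked (⟨i, 1⟩ :: p) (⟨j, b⁻¹⟩ :: L) := by
      rintro ⟨⟨i', L', h⟩, h2⟩
      apply h2
      simp only [List.cons.injEq, Sigma.mk.injEq] at h
      obtain ⟨⟨rfl, h⟩, rfl⟩ := h
      rw [eq_of_heq h]
      exact hj
    have hun2 := mt (hM ⟨⟨j, b⁻¹⟩ :: L, hL'⟩).1 hun
    rw [hb b⁻¹, mul_inv_cancel] at hun2
    have hsuf : (⟨j, 1⟩ :: (π ⟨L, hL⟩).1) <:+ (⟨i, 1⟩ :: p) := by
      by_contra hcon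
      exact hun2 ⟨⟨_, _, rfl⟩, hcon⟩
    have e := (List.suffix_of_suffix_length_le hsuf hj (by simp [hlen])).eq_of_length
      (by simp [hlen])
    simpa using e
  obtain ⟨a, ha⟩ := hloc p hp.le hp i
  refine ⟨a, ?_⟩
  have hmain : ∀ (L : List (Σ i, Γ i)) (hL : L.length ≤ N), act p i a L = (π ⟨L, hL⟩).1 := by
    intro L
    induction L with
    | nil => intro _; rw [hroot]; rfl
    | cons q L ih =>
      intro hL
      obtain ⟨i', g⟩ := q
      have hL' : L.length < N := hL
      obtain ⟨b, hb⟩ := hloc L hL'.le hL' i'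
      rw [hb g, ← ih hL'.le]
      simp only [act]
      congr 3
      by_cases hm : Marked (⟨i, 1⟩ :: p) (⟨i', 1⟩ :: L)
      · have hm2 := (hM ⟨⟨i', 1⟩ :: L, hL'⟩).2 hm
        rw [hb 1] at hm2
        obtain ⟨⟨i2, L2, h⟩, -⟩ := hm2
        simp only [List.cons.injEq, Sigma.mk.injEq, mul_one] at h
        obtain ⟨⟨rfl, h⟩, -⟩ := h
        rw [eq_of_heq h]
        split_ifs with hLp
        · subst hLp
          rw [Pi.mulSingle_eq_of_ne]
          rintro rfl
          exact hm.2 (List.suffix_refl _)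
        · rfl
      · have hsuf : (⟨i', 1⟩ :: L) <:+ (⟨i, 1⟩ :: p) := by
          by_contra hcon
          exact hm ⟨⟨_, _, rfl⟩, hcon⟩
        rcases List.suffix_cons_iff.1 hsuf with h | h
        · simp only [List.cons.injEq, Sigma.mk.injEq] at h
          obtain ⟨⟨rfl, -⟩, rfl⟩ := h
          simp only [if_true, Pi.mulSingle_eq_same]
          have := (hb 1).symm.trans (ha 1)
          simpa using this.symm
        · have hne : L ≠ p := by
            rintro rfl
            have := h.length_le
            simp at this
          rw [if_neg hne]
          have := (hb 1).symm.trans (hfix (⟨i', 1⟩ :: L) hL' h)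
          simp at this
          exact this.1.symm
  ext x : 2
  exact hmain x.1 x.2

end tree

/-! ### Assembly -/

lemma tree_aut {ι : Type} {Γ : ι → Type} [∀ i, Group (Γ i)] (N : ℕ)
    (code : (Prop × ((Σ i, Γ i) → Prop)) → ℕ) (hcode : Function.Injective code)
    (p : List (Σ i, Γ i)) (i : ι) (hp : p.length < N) (h1 : OnePath p) :
    Nonempty ((TG (BW (Node Γ N)) (kap (fun x y => code (colr x.1 y.1))
        {x | Marked (⟨i, 1⟩ :: p) x.1}) ≃g
      TG (BW (Node Γ N)) (kap (fun x y => code (colr x.1 y.1))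
        {x | Marked (⟨i, 1⟩ :: p) x.1})) ≃* Γ i) := by
  refine encode (theta p i N) (theta_inj p i N hp) ?_
  intro π
  constructor
  · rintro ⟨h2, h3⟩
    exact pres_surj hp h1 π (fun x y => hcode (h2 x y)) h3
  · rintro ⟨a, rfl⟩
    refine ⟨fun x y => by simp [act_colr], fun x => ⟨fun h => ?_, act_marked p i a⟩⟩
    have := act_marked p i a⁻¹ h
    simpa [← act_mul, act_one] using this

def autCongr {V V' : Type} {G : SimpleGraph V} {G' : SimpleGraph V'} (e : G ≃g G') :
    (G ≃g G) ≃* (G' ≃g G') where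
  toFun f := (e.symm.trans f).trans e
  invFun f := (e.trans f).trans e.symm
  left_inv f := by ext; simp
  right_inv f := by ext; simp
  map_mul' f g := by ext; simp

def indIso {V : Type} (G : SimpleGraph V) (S S' : Set V) (D : Set S)
    (h : ∀ x, x ∈ S' ↔ ∃ h : x ∈ S, (⟨x, h⟩ : S) ∈ D) :
    (G.induce S).induce D ≃g G.induce S' where
  toFun z := ⟨z.1.1, (h _).2 ⟨z.1.2, z.2⟩⟩
  invFun z := ⟨⟨z.1, ((h _).1 z.2).1⟩, ((h _).1 z.2).2⟩
  left_inv z := rfl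
  right_inv z := rfl
  map_rel_iff' := by intro a b; rfl


section path
variable {ι : Type} {Γ : ι → Type} [∀ i, Group (Γ i)]

def path (Γ : ι → Type) [∀ i, Group (Γ i)] (w : ℕ → ι) : ℕ → List (Σ i, Γ i)
  | 0 => []
  | n + 1 => ⟨w n, 1⟩ :: path Γ w n

@[simp] lemma path_length (w : ℕ → ι) (n : ℕ) : (path Γ w n).length = n := by
  induction n with
  | zero => rfl
  | succ n ih => simp [path, ih]

lemma path_one (w : ℕ → ι) (n : ℕ) : OnePath (path Γ w n) := by
  induction n with
  | zero => intro q hq; simp [path] at hq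
  | succ n ih =>
    intro q hq
    simp only [path, List.mem_cons] at hq
    rcases hq with rfl | hq
    · rfl
    · exact ih q hq

lemma path_suffix (w : ℕ → ι) (n : ℕ) (L : List (Σ i, Γ i)) :
    L <:+ path Γ w n ↔ ∃ m ≤ n, L = path Γ w m := by
  induction n with
  | zero => simp [path]
  | succ n ih =>
    rw [path, List.suffix_cons_iff, ih]
    constructor
    · rintro (h | ⟨m, hm, h⟩)
      · exact ⟨n + 1, le_rfl, h⟩
      · exact ⟨m, by omega, h⟩
    · rintro ⟨m, hm, h⟩
      rcases Nat.lt_or_ge n m with h' | h'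
      · obtain rfl : m = n + 1 := by omega
        exact Or.inl h
      · exact Or.inr ⟨m, h', h⟩

lemma path_congr (w w' : ℕ → ι) (n : ℕ) (h : ∀ m < n, w m = w' m) :
    path Γ w n = path Γ w' n := by
  induction n with
  | zero => rfl
  | succ n ih => rw [path, path, ih (fun m hm => h m (by omega)), h n (by omega)]

lemma marked_path (w : ℕ → ι) (n : ℕ) (x : List (Σ i, Γ i)) :
    Marked (path Γ w (n + 2)) x ↔
      Marked (path Γ w 1) x ∧ ∀ m ≤ n, x ≠ path Γ w (m + 2) := by
  unfold Marked
  rw [path_suffix, path_suffix]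
  constructor
  · rintro ⟨h1, h2⟩
    exact ⟨⟨h1, fun ⟨m, hm, h⟩ => h2 ⟨m, by omega, h⟩⟩, fun m hm h => h2 ⟨m + 2, by omega, h⟩⟩
  · rintro ⟨⟨h1, h2⟩, h3⟩
    refine ⟨h1, ?_⟩
    rintro ⟨m, hm, h⟩
    rcases Nat.lt_or_ge m 2 with h' | h'
    · exact h2 ⟨m, by omega, h⟩
    · exact h3 (m - 2) (by omega) (by rw [h]; congr 1; omega)

end path

def chSeq {k m : ℕ} (t : Fin m → Fin k) : ℕ → Fin (k + 1)
  | 0 => 0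
  | n + 1 => if h : n < m then (t ⟨n, h⟩).succ else 0

lemma finite_SK {W : Type} [Finite W] (κ : W → ℕ) : Finite (SK κ) := by
  refine Finite.of_injective
    (fun z => (⟨z.1.1, ⟨z.1.2, Nat.lt_succ_of_le z.2⟩⟩ : Σ w : W, Fin (κ w + 1))) ?_
  rintro ⟨⟨a, s⟩, h⟩ ⟨⟨b, t⟩, h'⟩ e
  simp only [Sigma.mk.injEq] at e
  obtain ⟨rfl, e⟩ := e
  simpa using e

lemma finite_WW (X : Type) [Finite X] : Finite (WW X) := by
  refine Finite.of_injective
    (fun z : WW X => (match z with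
      | .pt x => Sum.inl x
      | .e1 x y => Sum.inr (Sum.inl (x, y))
      | .e2 x y => Sum.inr (Sum.inr (x, y)) : X ⊕ ((X × X) ⊕ (X × X)))) ?_
  rintro (_ | _ | _) (_ | _ | _) h <;> simp_all

end VDG

open VDG

/-- **Adversarial iterated deletions (the vertex deletion game).** For all `k, ℓ ≥ 1`
and finite groups `Γ₀, Γ₁, …, Γₖ`, there is a finite simple graph `G₀` with
`Aut(G₀) ≅ Γ₀` and a strategy `σ` assigning to every nonempty sequence
`(i₁, …, i_j)` with `j ≤ ℓ` of adversary challenges in `{1, …, k}` a vertex of `G₀`,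
such that for every challenge sequence `(i₁, …, i_ℓ)`, the vertices
`v_j = σ(i₁, …, i_j)` are pairwise distinct and for each `j` the automorphism group
of the subgraph induced on `V(G₀) \ {v₁, …, v_j}` is isomorphic to `Γ_{i_j}`.
(A sequence of length `j` with `1 ≤ j ≤ ℓ` is modeled as `Fin (j' + 1) → Fin k` for
`j' : Fin ℓ`, and challenge `i ∈ {1, …, k}` as `i' : Fin k` with `Γ_i = Γ i'.succ`.) -/
theorem vertex_deletion_game (k ℓ : ℕ) (hk : 1 ≤ k) (hℓ : 1 ≤ ℓ)
    (Γ : Fin (k + 1) → Type) [∀ i, Group (Γ i)] [∀ i, Finite (Γ i)] :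
    ∃ (V : Type) (_ : Fintype V) (G : SimpleGraph V)
      (σ : (j : Fin ℓ) → (Fin (j + 1) → Fin k) → V),
      Nonempty ((G ≃g G) ≃* Γ 0) ∧
      ∀ s : Fin ℓ → Fin k, ∃ v : Fin ℓ → V,
        (∀ j : Fin ℓ, v j = σ j fun m => s (Fin.castLE j.isLt m)) ∧
        Function.Injective v ∧
        ∀ j : Fin ℓ,
          Nonempty ((G.induce ((v '' Set.Iic j)ᶜ : Set V) ≃g
            G.induce ((v '' Set.Iic j)ᶜ : Set V)) ≃* Γ (s j).succ) := by
  classical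
  have hcN : ∃ code : (Prop × ((Σ i, Γ i) → Prop)) → ℕ, Function.Injective code :=
    exists_injective_nat _
  obtain ⟨code, hcode⟩ := hcN
  set N := ℓ + 2 with hN
  have hfX : Finite (Node Γ N) := (List.finite_length_le (Σ i, Γ i) N).to_subtype
  have hfW : Finite (WW (Node Γ N)) := finite_WW _
  let κ : List (Σ i, Γ i) → WW (Node Γ N) → ℕ := fun p =>
    kap (fun x y => code (colr x.1 y.1)) {x | Marked p x.1}
  let p0 : List (Σ i, Γ i) := [⟨0, 1⟩]
  have hfS : Finite (SK (κ p0)) := finite_SK _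
  have hp0 : ∀ (m : ℕ) (t : Fin m → Fin k), path Γ (chSeq t) 1 = p0 := fun m t => rfl
  have hmem : ∀ (m : ℕ) (t : Fin m → Fin k) (j : ℕ) (hj : j < ℓ),
      ((WW.pt ⟨path Γ (chSeq t) (j + 2), by simp; omega⟩ : WW (Node Γ N)), 1) ∈ SK (κ p0) := by
    intro m t j hj
    have hm : Marked p0 (path Γ (chSeq t) (j + 2)) :=
      ⟨⟨_, _, rfl⟩, fun h => by have := h.length_le; simp [p0] at this⟩
    simp [SK, κ, kap, hm]
  refine ⟨SK (κ p0), Fintype.ofFinite _, TG (BW _) (κ p0),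
    fun j t => ⟨_, hmem _ t j j.2⟩, ?_, ?_⟩
  · exact tree_aut N code hcode [] 0 (by simp [hN]) (by intro q hq; simp at hq)
  · intro s
    refine ⟨fun j => ⟨_, hmem _ s j j.2⟩, ?_, ?_, ?_⟩
    · intro j
      have : path Γ (chSeq s) (j + 2) =
          path Γ (chSeq fun m : Fin (j + 1) => s (Fin.castLE j.isLt m)) (j + 2) := by
        apply path_congr
        intro m hm
        rcases m with _ | m
        · rfl
        · have h1 : m < ℓ := by omega
          have h2 : m < j.1 + 1 := by omega
          simp only [chSeq, dif_pos h1, dif_pos h2]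
          rfl
      simp only [this]
    · intro a b h
      have := congrArg (fun z : SK (κ p0) => match z.1.1 with
        | .pt x => x.1.length
        | _ => 0) h
      simp at this
      exact Fin.ext this
    · intro j
      have hiso := tree_aut N code hcode (path Γ (chSeq s) (j + 1)) (chSeq s (j + 1))
        (by simp; omega) (path_one _ _)
      have hs : chSeq s (j + 1) = (s j).succ := by simp [chSeq]
      rw [← hs]
      obtain ⟨e⟩ := hiso
      refine ⟨(autCongr (indIso (Tinf (BW (Node Γ N))) (SK (κ p0))
        (SK (κ (path Γ (chSeq s) (j + 2)))) _ ?_)).trans e⟩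
      rintro ⟨w, t⟩
      rcases w with x | ⟨x, y⟩ | ⟨x, y⟩
      · have hm := marked_path (Γ := Γ) (chSeq s) j x.1
        rw [hp0] at hm
        have hk : ∀ p, κ p (.pt x) = if Marked p x.1 then 1 else 0 := fun p => rfl
        have hS : ∀ p, ((WW.pt x : WW (Node Γ N)), t) ∈ SK (κ p) ↔
            t = 0 ∨ (t = 1 ∧ Marked p x.1) := by
          intro p
          show t ≤ κ p (.pt x) ↔ _
          rw [hk]
          split_ifs with h
          · simp only [h, and_true]; omega
          · simp only [h, and_false, or_false]; omega
        constructor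
        · intro h
          rw [hS] at h
          refine ⟨(hS _).2 (h.imp id (fun h => ⟨h.1, (hm.1 h.2).1⟩)), ?_⟩
          rintro ⟨a, ha, e⟩
          have e1 := congrArg Subtype.val e
          simp only [Prod.mk.injEq, WW.pt.injEq] at e1
          obtain ⟨e1, e2⟩ := e1
          rcases h with h | h
          · omega
          · exact (hm.1 h.2).2 a (by simpa using ha) (congrArg Subtype.val e1).symm
        · rintro ⟨h, h'⟩
          rw [hS]
          rcases (hS _).1 h with h0 | ⟨rfl, h0⟩
          · exact Or.inl h0
          · refine Or.inr ⟨rfl, hm.2 ⟨h0, fun m hmj e => h' ⟨⟨m, by omega⟩, hmj, ?_⟩⟩⟩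
            apply Subtype.ext
            simp only [Prod.mk.injEq, WW.pt.injEq, and_true]
            exact Subtype.ext e.symm
      · constructor
        · intro h
          refine ⟨h, ?_⟩
          rintro ⟨a, ha, e⟩
          have e1 := congrArg Subtype.val e
          simp at e1
        · exact fun h => h.1
      · constructor
        · intro h
          refine ⟨h, ?_⟩
          rintro ⟨a, ha, e⟩
          have e1 := congrArg Subtype.val e
          simp at e1
        · exact fun h => h.1
end
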